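/- Let 𝒞′, 𝒞, 𝒞″ be Hom-finite k-linear triangulated categories over a field k, each having a Serre functor. Then any recollement (𝒞′, 𝒞, 𝒞″) sits in an unbounded ladder of period 1. -/

import Mathlib

/-!
STATEMENT 4: Let 𝒞′, 𝒞, 𝒞″ be Hom-finite k-linear triangulated categories over a field k,
each having a Serre functor. Then any recollement (𝒞′, 𝒞, 𝒞″) sits in an unbounded ladder
of period 1.
-/
open CategoryTheory CategoryTheory.Limits CategoryTheory.Pretriangulated

section TriangulatedPreliminaries

universe v v' v'' u u' u''

variable {C : Type u} {C' : Type u'} {C'' : Type u''}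
  [Category.{v} C] [Category.{v'} C'] [Category.{v''} C'']
  [HasShift C ℤ] [HasShift C' ℤ] [HasShift C'' ℤ]
  [Preadditive C] [Preadditive C'] [Preadditive C'']
  [HasZeroObject C] [HasZeroObject C'] [HasZeroObject C'']
  [∀ n : ℤ, (shiftFunctor C n).Additive] [∀ n : ℤ, (shiftFunctor C' n).Additive]
  [∀ n : ℤ, (shiftFunctor C'' n).Additive]
  [Pretriangulated C] [Pretriangulated C'] [Pretriangulated C'']

/-- A functor between pretriangulated categories is a triangle functor if it admits a
commutation structure with the shifts for which it preserves distinguished triangles. -/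
def IsTriangleFunctor (F : C ⥤ C') : Prop :=
  ∃ c : F.CommShift ℤ, @Functor.IsTriangulated _ _ _ _ _ _ F c _ _ _ _ _ _ _ _

/-- The kernel of a functor: the class of objects sent to a zero object. -/
def kerSet (F : C ⥤ C') : Set C := { X | IsZero (F.obj X) }

/-- A left recollement `(𝒞', 𝒞, 𝒞'', i^*, i_*, j_!, j^*)`: there are adjoint pairs
`(i^*, i_*)` and `(j_!, j^*)`, the functors `i_*`, `j_!` are fully faithful, `j^* i_* = 0`,
and every object `X` fits in a distinguished triangle
`j_! j^* X ⟶ X ⟶ i_* i^* X ⟶ (j_! j^* X)[1]` whose morphisms into and out of `X` are the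
counit and the unit of the adjunctions. -/
def IsLeftRecollement (iStar : C ⥤ C') (iPush : C' ⥤ C)
    (jShriek : C'' ⥤ C) (jStar : C ⥤ C'') : Prop :=
  ∃ (adjI : iStar ⊣ iPush) (adjJ : jShriek ⊣ jStar),
    iPush.Full ∧ iPush.Faithful ∧ jShriek.Full ∧ jShriek.Faithful ∧
    (∀ X' : C', IsZero (jStar.obj (iPush.obj X'))) ∧
    (∀ X : C, ∃ h : iPush.obj (iStar.obj X) ⟶ (jShriek.obj (jStar.obj X))⟦(1 : ℤ)⟧,
      Triangle.mk (adjJ.counit.app X) (adjI.unit.app X) h ∈ distTriang C)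

/-- A recollement `(𝒞', 𝒞, 𝒞'', i^*, i_*, i^!, j_!, j^*, j_*)`, i.e. the data of
conditions (R1)-(R4): adjoint pairs `(i^*, i_*)`, `(i_*, i^!)`, `(j_!, j^*)`, `(j^*, j_*)`;
`i_*`, `j_!`, `j_*` fully faithful; `j^* i_* = 0`; and the two recollement distinguished
triangles `j_! j^* X ⟶ X ⟶ i_* i^* X ⟶ ⋅[1]` and `i_* i^! X ⟶ X ⟶ j_* j^* X ⟶ ⋅[1]`, whose
morphisms into and out of `X` are counits and units of the adjunctions. -/
def IsRecollement (iStar : C ⥤ C') (iPush : C' ⥤ C) (iShriek : C ⥤ C')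
    (jShriek : C'' ⥤ C) (jStar : C ⥤ C'') (jPush : C'' ⥤ C) : Prop :=
  ∃ (adjI₁ : iStar ⊣ iPush) (adjI₂ : iPush ⊣ iShriek)
    (adjJ₁ : jShriek ⊣ jStar) (adjJ₂ : jStar ⊣ jPush),
    iPush.Full ∧ iPush.Faithful ∧ jShriek.Full ∧ jShriek.Faithful ∧
    jPush.Full ∧ jPush.Faithful ∧
    (∀ X' : C', IsZero (jStar.obj (iPush.obj X'))) ∧
    (∀ X : C, ∃ h : iPush.obj (iStar.obj X) ⟶ (jShriek.obj (jStar.obj X))⟦(1 : ℤ)⟧,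
      Triangle.mk (adjJ₁.counit.app X) (adjI₁.unit.app X) h ∈ distTriang C) ∧
    (∀ X : C, ∃ h : jPush.obj (jStar.obj X) ⟶ (iPush.obj (iShriek.obj X))⟦(1 : ℤ)⟧,
      Triangle.mk (adjI₂.counit.app X) (adjJ₂.unit.app X) h ∈ distTriang C)

/-- An unbounded ladder of triangle functors, encoded by the four families
`a n = i_{2n} : 𝒞' ⥤ 𝒞`, `b n = i_{2n-1} : 𝒞'' ⥤ 𝒞`, `p n = j_{2n-1} : 𝒞 ⥤ 𝒞'` and
`q n = j_{2n} : 𝒞 ⥤ 𝒞''` (`n ∈ ℤ`): any two consecutive rows form a left or a right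
recollement of `𝒞` relative to `𝒞'` and `𝒞''`. -/
structure IsUnboundedLadder (a : ℤ → C' ⥤ C) (b : ℤ → C'' ⥤ C)
    (p : ℤ → C ⥤ C') (q : ℤ → C ⥤ C'') : Prop where
  tri_a : ∀ n, IsTriangleFunctor (a n)
  tri_b : ∀ n, IsTriangleFunctor (b n)
  tri_p : ∀ n, IsTriangleFunctor (p n)
  tri_q : ∀ n, IsTriangleFunctor (q n)
  left : ∀ n : ℤ, IsLeftRecollement (p n) (a n) (b n) (q n)
  right : ∀ n : ℤ, IsLeftRecollement (q n) (b (n + 1)) (a n) (p (n + 1))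

/-- The recollement `(i^*, i_*, i^!, j_!, j^*, j_*)` sits in an unbounded ladder, namely as
the `0`-th recollement `(j_{-1}, i_0, j_1, i_{-1}, j_0, i_1)` of the ladder. -/
def SitsInUnboundedLadder (iStar : C ⥤ C') (iPush : C' ⥤ C) (iShriek : C ⥤ C')
    (jShriek : C'' ⥤ C) (jStar : C ⥤ C'') (jPush : C'' ⥤ C) : Prop :=
  ∃ (a : ℤ → C' ⥤ C) (b : ℤ → C'' ⥤ C) (p : ℤ → C ⥤ C') (q : ℤ → C ⥤ C''),
    IsUnboundedLadder a b p q ∧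
    p 0 = iStar ∧ a 0 = iPush ∧ p 1 = iShriek ∧
    b 0 = jShriek ∧ q 0 = jStar ∧ b 1 = jPush

end TriangulatedPreliminaries
section RecollementEquivalences

variable {C₁ C₁' C₁'' C₂ C₂' C₂'' : Type*}
  [Category C₁] [Category C₁'] [Category C₁''] [Category C₂] [Category C₂'] [Category C₂'']
  [HasShift C₁ ℤ] [HasShift C₁' ℤ] [HasShift C₁'' ℤ]
  [HasShift C₂ ℤ] [HasShift C₂' ℤ] [HasShift C₂'' ℤ]
  [Preadditive C₁] [Preadditive C₁'] [Preadditive C₁'']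
  [Preadditive C₂] [Preadditive C₂'] [Preadditive C₂'']
  [HasZeroObject C₁] [HasZeroObject C₁'] [HasZeroObject C₁'']
  [HasZeroObject C₂] [HasZeroObject C₂'] [HasZeroObject C₂'']
  [∀ n : ℤ, (shiftFunctor C₁ n).Additive] [∀ n : ℤ, (shiftFunctor C₁' n).Additive]
  [∀ n : ℤ, (shiftFunctor C₁'' n).Additive]
  [∀ n : ℤ, (shiftFunctor C₂ n).Additive] [∀ n : ℤ, (shiftFunctor C₂' n).Additive]
  [∀ n : ℤ, (shiftFunctor C₂'' n).Additive]
  [Pretriangulated C₁] [Pretriangulated C₁'] [Pretriangulated C₁'']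
  [Pretriangulated C₂] [Pretriangulated C₂'] [Pretriangulated C₂'']

/-- An equivalence of left recollements: a triple `(F', F, F'')` of triangle-equivalences
commuting with the four functors up to natural isomorphism. -/
def IsLeftRecollementEquiv (F' : C₁' ⥤ C₂') (F : C₁ ⥤ C₂) (F'' : C₁'' ⥤ C₂'')
    (iStar₁ : C₁ ⥤ C₁') (iPush₁ : C₁' ⥤ C₁) (jShriek₁ : C₁'' ⥤ C₁) (jStar₁ : C₁ ⥤ C₁'')
    (iStar₂ : C₂ ⥤ C₂') (iPush₂ : C₂' ⥤ C₂) (jShriek₂ : C₂'' ⥤ C₂) (jStar₂ : C₂ ⥤ C₂'') :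
    Prop :=
  F'.IsEquivalence ∧ F.IsEquivalence ∧ F''.IsEquivalence ∧
  IsTriangleFunctor F' ∧ IsTriangleFunctor F ∧ IsTriangleFunctor F'' ∧
  Nonempty (iStar₁ ⋙ F' ≅ F ⋙ iStar₂) ∧ Nonempty (iPush₁ ⋙ F ≅ F' ⋙ iPush₂) ∧
  Nonempty (jShriek₁ ⋙ F ≅ F'' ⋙ jShriek₂) ∧ Nonempty (jStar₁ ⋙ F'' ≅ F ⋙ jStar₂)

/-- An equivalence of recollements: a triple `(F', F, F'')` of triangle-equivalences
commuting with the six functors up to natural isomorphism. -/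
def IsRecollementEquiv (F' : C₁' ⥤ C₂') (F : C₁ ⥤ C₂) (F'' : C₁'' ⥤ C₂'')
    (iStar₁ : C₁ ⥤ C₁') (iPush₁ : C₁' ⥤ C₁) (iShriek₁ : C₁ ⥤ C₁')
    (jShriek₁ : C₁'' ⥤ C₁) (jStar₁ : C₁ ⥤ C₁'') (jPush₁ : C₁'' ⥤ C₁)
    (iStar₂ : C₂ ⥤ C₂') (iPush₂ : C₂' ⥤ C₂) (iShriek₂ : C₂ ⥤ C₂')
    (jShriek₂ : C₂'' ⥤ C₂) (jStar₂ : C₂ ⥤ C₂'') (jPush₂ : C₂'' ⥤ C₂) : Prop :=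
  F'.IsEquivalence ∧ F.IsEquivalence ∧ F''.IsEquivalence ∧
  IsTriangleFunctor F' ∧ IsTriangleFunctor F ∧ IsTriangleFunctor F'' ∧
  Nonempty (iStar₁ ⋙ F' ≅ F ⋙ iStar₂) ∧ Nonempty (iPush₁ ⋙ F ≅ F' ⋙ iPush₂) ∧
  Nonempty (iShriek₁ ⋙ F' ≅ F ⋙ iShriek₂) ∧
  Nonempty (jShriek₁ ⋙ F ≅ F'' ⋙ jShriek₂) ∧ Nonempty (jStar₁ ⋙ F'' ≅ F ⋙ jStar₂) ∧
  Nonempty (jPush₁ ⋙ F ≅ F'' ⋙ jPush₂)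

end RecollementEquivalences

section LadderPeriod

variable {C C' C'' : Type*}
  [Category C] [Category C'] [Category C'']
  [HasShift C ℤ] [HasShift C' ℤ] [HasShift C'' ℤ]
  [Preadditive C] [Preadditive C'] [Preadditive C'']
  [HasZeroObject C] [HasZeroObject C'] [HasZeroObject C'']
  [∀ n : ℤ, (shiftFunctor C n).Additive] [∀ n : ℤ, (shiftFunctor C' n).Additive]
  [∀ n : ℤ, (shiftFunctor C'' n).Additive]
  [Pretriangulated C] [Pretriangulated C'] [Pretriangulated C'']

/-- In a ladder, the `s`-th left recollement is equivalent to the `t`-th one. -/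
def LadderLeftRecEquivAt (a : ℤ → C' ⥤ C) (b : ℤ → C'' ⥤ C)
    (p : ℤ → C ⥤ C') (q : ℤ → C ⥤ C'') (s t : ℤ) : Prop :=
  ∃ (F' : C' ⥤ C') (F : C ⥤ C) (F'' : C'' ⥤ C''),
    IsLeftRecollementEquiv F' F F'' (p s) (a s) (b s) (q s) (p t) (a t) (b t) (q t)

/-- An unbounded ladder is periodic of period `t`: `t` is the minimal positive integer such
that the `t`-th left recollement is equivalent to the `0`-th one. -/
def LadderHasPeriod (a : ℤ → C' ⥤ C) (b : ℤ → C'' ⥤ C)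
    (p : ℤ → C ⥤ C') (q : ℤ → C ⥤ C'') (t : ℤ) : Prop :=
  0 < t ∧ LadderLeftRecEquivAt a b p q t 0 ∧
    ∀ s : ℤ, 0 < s → s < t → ¬ LadderLeftRecEquivAt a b p q s 0

/-- The recollement `(i^*, i_*, i^!, j_!, j^*, j_*)` sits in an unbounded ladder
of period `t`. -/
def SitsInUnboundedLadderOfPeriod (iStar : C ⥤ C') (iPush : C' ⥤ C) (iShriek : C ⥤ C')
    (jShriek : C'' ⥤ C) (jStar : C ⥤ C'') (jPush : C'' ⥤ C) (t : ℤ) : Prop :=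
  ∃ (a : ℤ → C' ⥤ C) (b : ℤ → C'' ⥤ C) (p : ℤ → C ⥤ C') (q : ℤ → C ⥤ C''),
    IsUnboundedLadder a b p q ∧
    p 0 = iStar ∧ a 0 = iPush ∧ p 1 = iShriek ∧
    b 0 = jShriek ∧ q 0 = jStar ∧ b 1 = jPush ∧
    LadderHasPeriod a b p q t

end LadderPeriod
section Serre

variable (k : Type*) [Field k]
variable (E : Type*) [Category E] [Preadditive E] [CategoryTheory.Linear k E]

/-- The data exhibiting `S` as a right Serre functor on a Hom-finite `k`-linear category:
`k`-linear isomorphisms `Hom(X, Y) ≅ Hom(Y, S X)^*`, natural in `X` and `Y`. -/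
structure RightSerreData (S : E ⥤ E) where
  e : ∀ X Y : E, (X ⟶ Y) ≃ₗ[k] Module.Dual k (Y ⟶ S.obj X)
  nat_right : ∀ {X Y Y' : E} (h : X ⟶ Y) (g : Y ⟶ Y') (u : Y' ⟶ S.obj X),
    e X Y' (h ≫ g) u = e X Y h (g ≫ u)
  nat_left : ∀ {X X' Y : E} (f : X' ⟶ X) (h : X ⟶ Y) (u : Y ⟶ S.obj X'),
    e X' Y (f ≫ h) u = e X Y h (u ≫ S.map f)

/-- A category has a Serre functor if it has a right Serre functor which is an
equivalence. -/
def HasSerreFunctor : Prop :=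
  ∃ S : E ⥤ E, Nonempty (RightSerreData k E S) ∧ S.IsEquivalence

end Serre
section Duality

/-- The coinduced module. -/
def CoindE (k R : Type*) [Field k] [CommRing R] [Algebra k R] := R →ₗ[k] k

namespace CoindE
variable {k R : Type*} [Field k] [CommRing R] [Algebra k R]
noncomputable instance : AddCommGroup (CoindE k R) := inferInstanceAs (AddCommGroup (R →ₗ[k] k))

/-- evaluation -/
def ev (f : CoindE k R) : R →ₗ[k] k := f

@[ext] lemma ext {f g : CoindE k R} (h : ∀ r, f.ev r = g.ev r) : f = g :=
  LinearMap.ext (f := f.ev) (g := g.ev) h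

@[simp] lemma add_ev (f g : CoindE k R) : (f + g).ev = f.ev + g.ev := rfl
@[simp] lemma zero_ev : (0 : CoindE k R).ev = 0 := rfl

noncomputable instance : SMul R (CoindE k R) := ⟨fun r f => f.ev ∘ₗ LinearMap.mulLeft k r⟩
@[simp] lemma smul_ev (r : R) (f : CoindE k R) (s : R) : (r • f).ev s = f.ev (r * s) := rfl

noncomputable instance : Module R (CoindE k R) where
  one_smul f := by ext; simp
  mul_smul r s f := by ext t; simp only [smul_ev]; congr 1; ring
  smul_zero r := by ext; simp
  smul_add r f g := by ext; simp
  add_smul r s f := by ext; simp [add_mul]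
  zero_smul f := by ext; simp

/-- the map `M → E` attached to a functional on `M` -/
def sharp {M : Type*} [AddCommGroup M] [Module R M] [Module k M] [IsScalarTower k R M]
    (f : M →ₗ[k] k) : M →ₗ[R] CoindE k R where
  toFun m := (f ∘ₗ (LinearMap.toSpanSingleton R M m).restrictScalars k : R →ₗ[k] k)
  map_add' m n := by
    ext r
    change f (r • (m + n)) = f (r • m) + f (r • n)
    simp
  map_smul' s m := by
    ext r
    change f (r • (s • m)) = f ((s * r) • m)
    rw [smul_smul, mul_comm]

@[simp] lemma sharp_ev {M : Type*} [AddCommGroup M] [Module R M] [Module k M] [IsScalarTower k R M]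
    (f : M →ₗ[k] k) (m : M) (r : R) : (sharp (R := R) f m).ev r = f (r • m) := rfl

end CoindE

open CoindE

lemma CoindE.linearIndependent {k₁ k₂ R : Type*} [Field k₁] [Field k₂] [CommRing R] [Algebra k₁ R] [Algebra k₂ R]
    [Module k₂ (CoindE k₁ R)] [IsScalarTower k₂ R (CoindE k₁ R)]
    {ι : Type*} (m : ι → Ideal R) (hm : ∀ i, (m i).IsMaximal) (hinj : Function.Injective m)
    (x : ι → CoindE k₁ R) (hx : ∀ i, x i ≠ 0) (hmx : ∀ i, ∀ r ∈ m i, r • x i = 0) :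
    LinearIndependent k₂ x := by
  classical
  rw [linearIndependent_iff']
  intro s g hs i hi
  by_contra hgi
  have : ∃ r ∈ ∏ j ∈ s.erase i, m j, r ∉ m i := by
    by_contra! hc
    have hle : ∏ j ∈ s.erase i, m j ≤ m i := hc
    rw [(hm i).isPrime.prod_le] at hle
    obtain ⟨j, hj, hji⟩ := hle
    have := (hm j).eq_of_le (hm i).ne_top hji
    exact (Finset.ne_of_mem_erase hj) (hinj this)
  obtain ⟨r, hr, hri⟩ := this
  have h0 : g i • r • x i = 0 := by
    have := congrArg (fun y => r • y) hs
    simp only [Finset.smul_sum, smul_zero] at this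
    rw [Finset.sum_eq_single_of_mem i hi] at this
    · rw [← this, ← algebraMap_smul R (g i) (r • x i), ← algebraMap_smul R (g i) (x i), smul_comm]
    · intro j hj hji
      have hrj : r ∈ m j := by
        have := Ideal.prod_le_inf (s := s.erase i) (f := m) hr
        exact (Finset.inf_le (f := m) (Finset.mem_erase.2 ⟨hji, hj⟩)) this
      rw [← algebraMap_smul R (g j) (x j), smul_comm, hmx j r hrj, smul_zero]
  have h1 : r • x i = 0 := (smul_eq_zero.1 h0).resolve_left hgi
  have h2 := (hm i).isPrime
  obtain ⟨a, b, hb, hab⟩ := (hm i).exists_inv hri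
  apply hx i
  have := congrArg (fun t => t • x i) hab
  simpa [add_smul, mul_smul, h1, hmx i b hb] using this.symm

noncomputable instance CoindE.modk {k R : Type*} [Field k] [CommRing R] [Algebra k R] : Module k (CoindE k R) :=
  inferInstanceAs (Module k (R →ₗ[k] k))

instance {k R : Type*} [Field k] [CommRing R] [Algebra k R] : IsScalarTower k R (CoindE k R) where
  smul_assoc c r f := by
    ext s
    change f.ev ((c • r) * s) = c • f.ev (r * s)
    simp

/-- a functional which is nonzero on all small submodules -/
def CoindE.Good {k₁ k₂ R : Type*} [Field k₁] [Field k₂] [CommRing R] [Algebra k₁ R]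
    [Module k₂ (CoindE k₁ R)] (l : CoindE k₁ R →ₗ[k₂] k₂) : Prop :=
  ∀ (N : Submodule R (CoindE k₁ R)), N ≠ ⊥ → Module.Finite k₁ N → ∃ x ∈ N, l x ≠ 0

lemma CoindE.mem_span_of_max {k R : Type*} [Field k] [CommRing R] [Algebra k R]
    (m : Ideal R) [hm : m.IsMaximal] (x y : CoindE k R) (hy : y ≠ 0) (hmx : ∀ r ∈ m, r • x = 0)
    (hmy : ∀ r ∈ m, r • y = 0) (hfin : Module.Finite k (Submodule.span R {y})) :
    x ∈ Submodule.span R {y} := by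
  -- E[m]
  let Em : Submodule R (CoindE k R) :=
    { carrier := {z | ∀ r ∈ m, r • z = 0}
      add_mem' := fun {a b} ha hb r hr => by rw [smul_add, ha r hr, hb r hr, add_zero]
      zero_mem' := fun r _ => smul_zero r
      smul_mem' := fun c z hz r hr => by rw [smul_comm, hz r hr, smul_zero] }
  have hle : Submodule.span R {y} ≤ Em := by
    rw [Submodule.span_singleton_le_iff_mem]; exact hmy
  -- R/m ≃ span y
  let q : (R ⧸ m) →ₗ[R] Submodule.span R {y} :=
    m.liftQ (LinearMap.toSpanSingleton R _ ⟨y, Submodule.mem_span_singleton_self y⟩)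
      (fun r hr => by
        rw [LinearMap.mem_ker]
        ext1
        simpa using hmy r hr)
  have hqs : Function.Surjective q := by
    rintro ⟨z, hz⟩
    obtain ⟨r, rfl⟩ := Submodule.mem_span_singleton.1 hz
    exact ⟨Ideal.Quotient.mk m r, rfl⟩
  have hqi : Function.Injective q := by
    rw [injective_iff_map_eq_zero]
    intro a ha
    obtain ⟨r, rfl⟩ := Ideal.Quotient.mk_surjective a
    have hr : r • y = 0 := congrArg Subtype.val ha
    by_contra hne
    have hri : r ∉ m := fun h => hne (Ideal.Quotient.eq_zero_iff_mem.2 h)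
    obtain ⟨a, b, hb, hab⟩ := hm.exists_inv hri
    apply hy
    have := congrArg (fun t => t • y) hab
    simpa [add_smul, mul_smul, hr, hmy b hb] using this.symm
  let qe : (R ⧸ m) ≃ₗ[k] Submodule.span R {y} := (LinearEquiv.ofBijective q ⟨hqi, hqs⟩).restrictScalars k
  have : Module.Finite k (R ⧸ m) := Module.Finite.equiv qe.symm
  -- Em → Dual (R/m)
  let d : Em →ₗ[k] Module.Dual k (R ⧸ m) :=
    { toFun := fun z => (m.restrictScalars k).liftQ z.1.ev (fun r hr => by
        have := congrArg (fun t => t.ev 1) (z.2 r hr)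
        simpa using this)
      map_add' := fun a b => by
        ext r
        rfl
      map_smul' := fun c a => by
        ext r
        rfl }
  have hd : Function.Injective d := by
    intro a b hab
    ext r
    exact congrArg (fun t => t (Ideal.Quotient.mk m r)) hab
  have : Module.Finite k Em := Module.Finite.of_injective d hd
  have h1 := LinearMap.finrank_le_finrank_of_injective hd
  rw [Subspace.dual_finrank_eq, qe.finrank_eq] at h1
  have h2 : (Submodule.span R {y}).restrictScalars k = Em.restrictScalars k := by
    have : FiniteDimensional k (Em.restrictScalars k) := ‹Module.Finite k Em›
    exact Submodule.eq_of_le_of_finrank_le hle h1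
  have : x ∈ Em.restrictScalars k := hmx
  rw [← h2] at this
  exact this

lemma CoindE.exists_good {k₁ k₂ R : Type*} [Field k₁] [Field k₂] [CommRing R] [Algebra k₁ R] [Algebra k₂ R]
    [Module k₂ (CoindE k₁ R)] [IsScalarTower k₂ R (CoindE k₁ R)]
    (m₀ : Ideal R) (hm₀ : m₀.IsMaximal) (x₀ : CoindE k₁ R) (hx₀ : x₀ ≠ 0) (hmx₀ : ∀ r ∈ m₀, r • x₀ = 0) :
    ∃ l : CoindE k₁ R →ₗ[k₂] k₂, CoindE.Good l ∧ l x₀ = 1 := by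
  classical
  let ι := {m : Ideal R // m.IsMaximal ∧ ∃ x : CoindE k₁ R, x ≠ 0 ∧ ∀ r ∈ m, r • x = 0}
  let i₀ : ι := ⟨m₀, hm₀, x₀, hx₀, hmx₀⟩
  have H : ∀ i : ι, ∃ x : CoindE k₁ R, x ≠ 0 ∧ (∀ r ∈ i.1, r • x = 0) ∧ (i = i₀ → x = x₀) := by
    intro i
    by_cases h : i = i₀
    · subst h; exact ⟨x₀, hx₀, hmx₀, fun _ => rfl⟩
    · obtain ⟨x, h1, h2⟩ := i.2.2
      exact ⟨x, h1, h2, fun h' => absurd h' h⟩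
  choose x hx1 hx2 hx3 using H
  have hli : LinearIndependent k₂ x :=
    CoindE.linearIndependent (fun i : ι => i.1) (fun i => i.2.1) Subtype.val_injective x hx1 hx2
  obtain ⟨l, hl⟩ := ((Module.Basis.span hli).constr k₂ (fun _ => (1 : k₂))).exists_extend
  have hlx : ∀ i, l (x i) = 1 := by
    intro i
    have := congrArg (fun t => t (Module.Basis.span hli i)) hl
    change (l ∘ₗ Submodule.subtype _) (Module.Basis.span hli i) = _ at this
    rw [Module.Basis.constr_basis] at this
    rw [← this, LinearMap.comp_apply, Submodule.subtype_apply, Module.Basis.span_apply]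
  refine ⟨l, ?_, by rw [← hx3 i₀ rfl, hlx]⟩
  intro N hN hfin
  have : IsArtinian k₁ N := inferInstance
  have : IsArtinian R N := isArtinian_of_tower k₁ this
  have : Nontrivial N := (Submodule.nontrivial_iff_ne_bot).2 hN
  obtain ⟨S, hS⟩ := IsAtomic.exists_atom (Submodule R N)
  have hSs : IsSimpleModule R S := isSimpleModule_iff_isAtom.2 hS
  have : Nontrivial S := IsSimpleModule.nontrivial R S
  obtain ⟨y, hy⟩ := exists_ne (0 : S)
  have hmax : Ideal.IsMaximal (LinearMap.ker (LinearMap.toSpanSingleton R S y)) :=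
    IsSimpleModule.ker_toSpanSingleton_isMaximal R hy
  set m := LinearMap.ker (LinearMap.toSpanSingleton R S y)
  have hmy : ∀ r ∈ m, r • (y.1.1) = 0 := by
    intro r hr
    have : r • y = 0 := by simpa [m] using hr
    exact congrArg (fun t => t.1.1) this
  have hy' : (y.1.1) ≠ 0 := by
    intro h; apply hy; ext1; ext1; exact h
  let i : ι := ⟨m, hmax, y.1.1, hy', hmy⟩
  have hle : Submodule.span R {y.1.1} ≤ N := by
    rw [Submodule.span_singleton_le_iff_mem]; exact y.1.2
  have : Module.Finite k₁ (Submodule.span R {y.1.1}) :=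
    Module.Finite.of_injective ((Submodule.inclusion hle).restrictScalars k₁) (Submodule.inclusion_injective hle)
  have := CoindE.mem_span_of_max m (x i) y.1.1 hy' (hx2 i) hmy this
  exact ⟨x i, hle this, by rw [hlx]; exact one_ne_zero⟩

/-- The comparison map between the two duals. -/
noncomputable def dualComp {k₁ k₂ R : Type*} [Field k₁] [Field k₂] [CommRing R] [Algebra k₁ R] [Algebra k₂ R]
    [Module k₂ (CoindE k₁ R)] [IsScalarTower k₂ R (CoindE k₁ R)] (l : CoindE k₁ R →ₗ[k₂] k₂)
    {M : Type*} [AddCommGroup M] [Module R M] [Module k₁ M] [IsScalarTower k₁ R M]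
    [Module k₂ M] [IsScalarTower k₂ R M] (f : M →ₗ[k₁] k₁) : M →ₗ[k₂] k₂ :=
  l ∘ₗ (CoindE.sharp (R := R) f).restrictScalars k₂

lemma dualComp_apply {k₁ k₂ R : Type*} [Field k₁] [Field k₂] [CommRing R] [Algebra k₁ R] [Algebra k₂ R]
    [Module k₂ (CoindE k₁ R)] [IsScalarTower k₂ R (CoindE k₁ R)] (l : CoindE k₁ R →ₗ[k₂] k₂)
    {M : Type*} [AddCommGroup M] [Module R M] [Module k₁ M] [IsScalarTower k₁ R M]
    [Module k₂ M] [IsScalarTower k₂ R M] (f : M →ₗ[k₁] k₁) (m : M) :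
    dualComp l f m = l (CoindE.sharp (R := R) f m) := rfl

lemma dualComp_naturality {k₁ k₂ R : Type*} [Field k₁] [Field k₂] [CommRing R] [Algebra k₁ R] [Algebra k₂ R]
    [Module k₂ (CoindE k₁ R)] [IsScalarTower k₂ R (CoindE k₁ R)] (l : CoindE k₁ R →ₗ[k₂] k₂)
    {M : Type*} [AddCommGroup M] [Module R M] [Module k₁ M] [IsScalarTower k₁ R M]
    [Module k₂ M] [IsScalarTower k₂ R M]
    {N : Type*} [AddCommGroup N] [Module R N] [Module k₁ N] [IsScalarTower k₁ R N]
    [Module k₂ N] [IsScalarTower k₂ R N] (g : M →ₗ[R] N) (f : N →ₗ[k₁] k₁) (f' : M →ₗ[k₁] k₁)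
    (hf : ∀ m, f' m = f (g m)) (m : M) :
    dualComp l f' m = dualComp l f (g m) := by
  rw [dualComp_apply, dualComp_apply]
  congr 1
  ext r
  simp [hf]

section
variable {k₁ k₂ R : Type*} [Field k₁] [Field k₂] [CommRing R] [Algebra k₁ R] [Algebra k₂ R]
    [Module k₂ (CoindE k₁ R)] [IsScalarTower k₂ R (CoindE k₁ R)] (l : CoindE k₁ R →ₗ[k₂] k₂)
    {M : Type*} [AddCommGroup M] [Module R M] [Module k₁ M] [IsScalarTower k₁ R M]
    [Module k₂ M] [IsScalarTower k₂ R M]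

lemma dualComp_sub (f f' : M →ₗ[k₁] k₁) : dualComp (R := R) l (f - f') = dualComp (R := R) l f - dualComp (R := R) l f' := by
  ext m
  rw [LinearMap.sub_apply, dualComp_apply, dualComp_apply, dualComp_apply, ← map_sub]
  congr 1

lemma dualComp_injective (hl : CoindE.Good l) [Module.Finite k₁ M] :
    Function.Injective (dualComp (R := R) l : (M →ₗ[k₁] k₁) → (M →ₗ[k₂] k₂)) := by
  intro f f' hff
  rw [← sub_eq_zero, ← dualComp_sub] at hff
  rw [← sub_eq_zero]
  generalize f - f' = g at *
  by_contra hg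
  have hN : LinearMap.range (CoindE.sharp (R := R) g) ≠ ⊥ := by
    intro h
    apply hg
    rw [LinearMap.range_eq_bot] at h
    ext m
    have := congrArg (fun t => (t m).ev 1) h
    simpa using this
  have : Module.Finite k₁ (LinearMap.range (CoindE.sharp (R := R) g)) :=
    Module.Finite.of_surjective ((CoindE.sharp (R := R) g).rangeRestrict.restrictScalars k₁)
      (LinearMap.surjective_rangeRestrict _)
  obtain ⟨x, ⟨m, rfl⟩, hx⟩ := hl _ hN this
  exact hx (congrArg (fun t => t m) hff)

lemma dualComp_bijective [Module k₁ (CoindE k₂ R)] [IsScalarTower k₁ R (CoindE k₂ R)]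
    (hl : CoindE.Good l) (l' : CoindE k₂ R →ₗ[k₁] k₁) (hl' : CoindE.Good l') [Module.Finite k₁ M] [Module.Finite k₂ M] :
    Function.Bijective (dualComp (R := R) l : (M →ₗ[k₁] k₁) → (M →ₗ[k₂] k₂)) := by
  refine ⟨dualComp_injective l hl, ?_⟩
  let T : (M →ₗ[k₂] k₂) →ₗ[k₂] (M →ₗ[k₂] k₂) :=
    { toFun := fun f => dualComp (R := R) l (dualComp (R := R) l' f)
      map_add' := fun f f' => by
        ext m
        have : dualComp (R := R) l' (f + f') = dualComp (R := R) l' f + dualComp (R := R) l' f' := by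
          ext m
          rw [LinearMap.add_apply, dualComp_apply, dualComp_apply, dualComp_apply, ← map_add]
          congr 1
        rw [this, LinearMap.add_apply, dualComp_apply, dualComp_apply, dualComp_apply, ← map_add]
        congr 1
      map_smul' := fun c f => by
        ext m
        let g : M →ₗ[R] M := LinearMap.lsmul R M (algebraMap k₂ R c)
        have hg : ∀ m, g m = c • m := fun m => by simp [g]
        have h1 : ∀ m, dualComp (R := R) l' (c • f) m = dualComp (R := R) l' f (g m) :=
          dualComp_naturality l' g f (c • f) (fun m => by rw [hg]; simp)
        have h2 := dualComp_naturality l g (dualComp (R := R) l' f) _ h1 m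
        rw [h2, hg]
        simp }
  have hT : Function.Injective T := (dualComp_injective l hl).comp (dualComp_injective l' hl')
  have hTs : Function.Surjective T := LinearMap.injective_iff_surjective.1 hT
  intro f
  obtain ⟨g, rfl⟩ := hTs f
  exact ⟨_, rfl⟩
end
end Duality

section Phi
open TensorProduct

/-- a copy of the field, used to have two different scalar actions -/
def K2 (k : Type*) := k
instance (k : Type*) [Field k] : Field (K2 k) := inferInstanceAs (Field k)

/-- the identification -/
def K2.toK (k : Type*) [Field k] : K2 k ≃+* k := RingEquiv.refl k

/-- the ring acting through both copies -/
def RR (k : Type*) [Field k] := k ⊗[ℤ] (K2 k)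

variable {k : Type*} [Field k]

noncomputable instance : CommRing (RR k) := inferInstanceAs (CommRing (k ⊗[ℤ] (K2 k)))

/-- pure tensors -/
noncomputable def RR.tm (a : k) (b : K2 k) : RR k := (a ⊗ₜ[ℤ] b : k ⊗[ℤ] (K2 k))

lemma RR.ind {P : RR k → Prop} (r : RR k) (h0 : P 0) (h1 : ∀ a b, P (RR.tm a b))
    (h2 : ∀ x y, P x → P y → P (x + y)) : P r :=
  TensorProduct.induction_on (motive := P) r h0 h1 h2

lemma RR.tm_mul (a c : k) (b d : K2 k) : RR.tm a b * RR.tm c d = RR.tm (a * c) (b * d) :=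
  Algebra.TensorProduct.tmul_mul_tmul a c b d

/-- action of the first copy -/
noncomputable instance RR.alg1 : Algebra k (RR k) :=
  (Algebra.TensorProduct.includeLeftRingHom : k →+* k ⊗[ℤ] (K2 k)).toAlgebra

/-- action of the second copy -/
noncomputable instance RR.alg2 : Algebra (K2 k) (RR k) :=
  (Algebra.TensorProduct.includeRight : K2 k →ₐ[ℤ] k ⊗[ℤ] (K2 k)).toRingHom.toAlgebra

lemma RR.smul1 (c : k) (r : RR k) : c • r = RR.tm c 1 * r := rfl
lemma RR.smul2 (c : K2 k) (r : RR k) : c • r = RR.tm 1 c * r := rfl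

noncomputable instance : Module (K2 k) (CoindE k (RR k)) := Module.compHom _ (algebraMap (K2 k) (RR k))
noncomputable instance : Module k (CoindE (K2 k) (RR k)) := Module.compHom _ (algebraMap k (RR k))
instance : IsScalarTower (K2 k) (RR k) (CoindE k (RR k)) where
  smul_assoc a b c := by
    rw [Algebra.smul_def]; exact mul_smul _ b c
instance : IsScalarTower k (RR k) (CoindE (K2 k) (RR k)) where
  smul_assoc a b c := by
    rw [Algebra.smul_def]; exact mul_smul _ b c

variable (k) in
/-- multiplication -/
noncomputable def epsRing : RR k →+* k :=
  show k ⊗[ℤ] (K2 k) →+* k from (Algebra.TensorProduct.lift (AlgHom.id ℤ k : k →ₐ[ℤ] k) ((K2.toK k).toRingHom.toIntAlgHom)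
    (fun _ _ => Commute.all _ _)).toRingHom

lemma epsRing_tmul (a : k) (b : K2 k) : epsRing k (RR.tm a b) = a * K2.toK k b := rfl

variable (k) in
/-- the augmentation as an element of the coinduced module -/
noncomputable def eps1 : CoindE k (RR k) :=
  ({ toFun := epsRing k, map_add' := map_add _,
     map_smul' := fun c x => by
      rw [RR.smul1, map_mul]
      simp [epsRing_tmul]
      } : RR k →ₗ[k] k)

lemma eps1_ev (r : RR k) : (eps1 k).ev r = epsRing k r := rfl

variable (k) in
/-- the same for the second copy -/
noncomputable def eps2 : CoindE (K2 k) (RR k) :=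
  ({ toFun := fun x => (K2.toK k).symm (epsRing k x : k), map_add' := fun x y => by simp,
     map_smul' := fun c x => by
      rw [RR.smul2, map_mul, epsRing_tmul, one_mul]
      simp } : RR k →ₗ[K2 k] K2 k)

lemma eps2_ev (r : RR k) : (eps2 k).ev r = (K2.toK k).symm (epsRing k r) := rfl

lemma ker_eps_max : (RingHom.ker (epsRing k)).IsMaximal :=
  RingHom.ker_isMaximal_of_surjective _ (fun a => ⟨RR.tm a 1, by
    rw [epsRing_tmul]; simp⟩)

lemma exists_lam1 : ∃ l : CoindE k (RR k) →ₗ[K2 k] K2 k, CoindE.Good l ∧ l (eps1 k) = 1 := by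
  refine CoindE.exists_good (RingHom.ker (epsRing k)) ker_eps_max _ ?_ ?_
  · intro h
    have := congrArg (fun t => t.ev 1) h
    simp [eps1_ev] at this
  · intro r hr
    ext s
    rw [RingHom.mem_ker] at hr
    simp [eps1_ev, hr]

lemma exists_lam2 : ∃ l : CoindE (K2 k) (RR k) →ₗ[k] k, CoindE.Good l := by
  obtain ⟨l, h, -⟩ := CoindE.exists_good (k₁ := K2 k) (k₂ := k) (R := RR k) (RingHom.ker (epsRing k)) ker_eps_max (eps2 k) (by
    intro h
    have := congrArg (fun t => t.ev 1) h
    simp [eps2_ev] at this) (by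
    intro r hr
    ext s
    rw [RingHom.mem_ker] at hr
    simp [eps2_ev, hr])
  exact ⟨l, h⟩

variable (k) in
/-- the chosen functional -/
noncomputable def lam1 : CoindE k (RR k) →ₗ[K2 k] K2 k := exists_lam1.choose

variable {M N M' N' : Type*} [AddCommGroup M] [Module k M] [AddCommGroup N] [Module k N]
  [AddCommGroup M'] [Module k M'] [AddCommGroup N'] [Module k N']

/-- compatibility of the two module structures -/
def CommActs (k : Type*) [Field k] {M N : Type*} [AddCommGroup M] [Module k M] [AddCommGroup N] [Module k N]
    (e : M ≃+ N) : Prop :=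
  ∀ (c d : k) (m : M), e.symm (d • e (c • m)) = c • e.symm (d • e m)

/-- a copy of `M` with two actions -/
def M2 {k : Type*} [Field k] {M N : Type*} [AddCommGroup M] [Module k M] [AddCommGroup N] [Module k N] {e : M ≃+ N} (_ : CommActs k e) := M

variable {e : M ≃+ N} (h : CommActs k e)
instance : AddCommGroup (M2 h) := inferInstanceAs (AddCommGroup M)
instance : Module k (M2 h) := inferInstanceAs (Module k M)
instance [h' : Module.Finite k M] : Module.Finite k (M2 h) := h'

/-- identity -/
def M2.equiv : M2 h ≃+ N := e

noncomputable instance : SMul (K2 k) (M2 h) := ⟨fun d m => (M2.equiv h).symm (K2.toK k d • M2.equiv h m)⟩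

lemma M2.smul_def (d : K2 k) (m : M2 h) : d • m = (M2.equiv h).symm (K2.toK k d • M2.equiv h m) := rfl
lemma M2.smul_def1 (d : k) (m : M2 h) : d • m = (M2.equiv h).symm (M2.equiv h (d • m)) := by simp

noncomputable instance : Module (K2 k) (M2 h) where
  one_smul m := by simp [M2.smul_def]
  mul_smul a b m := by simp [M2.smul_def, mul_smul]
  smul_zero a := by simp [M2.smul_def]
  smul_add a x y := by simp [M2.smul_def]
  add_smul a b x := by simp [M2.smul_def, add_smul]
  zero_smul x := by simp [M2.smul_def]

instance M2.smulComm : SMulCommClass k (K2 k) (M2 h) where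
  smul_comm c d m := (h c (K2.toK k d) m).symm

noncomputable instance M2.modR : Module (RR k) (M2 h) :=
  (TensorProduct.Algebra.module : Module (k ⊗[ℤ] (K2 k)) (M2 h))

lemma M2.tmul_smul (a : k) (b : K2 k) (m : M2 h) : (RR.tm a b) • m = a • b • m := rfl

instance : IsScalarTower k (RR k) (M2 h) where
  smul_assoc a b m := by
    rw [RR.smul1, mul_smul, M2.tmul_smul, one_smul]

instance : IsScalarTower (K2 k) (RR k) (M2 h) where
  smul_assoc a b m := by
    rw [RR.smul2, mul_smul, M2.tmul_smul, one_smul]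

/-- identity -/
def M2.toM : M2 h ≃ₗ[k] M := LinearEquiv.refl k M

lemma M2.equiv_eq (m : M2 h) : M2.equiv h m = e (M2.toM h m) := rfl
lemma M2.equiv_symm_eq (n : N) : M2.toM h ((M2.equiv h).symm n) = e.symm n := rfl

instance M2.fin2 [h' : Module.Finite k N] : Module.Finite (K2 k) (M2 h) := by
  obtain ⟨s, hs⟩ := h'.fg_top
  classical
  refine ⟨⟨s.image (M2.equiv h).symm, ?_⟩⟩
  rw [eq_top_iff]
  rintro m -
  obtain ⟨n, rfl⟩ := (M2.equiv h).symm.surjective m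
  have hn : n ∈ Submodule.span k (s : Set N) := hs ▸ Submodule.mem_top
  induction hn using Submodule.span_induction with
  | mem x hx => exact Submodule.subset_span (Finset.mem_coe.2 (Finset.mem_image_of_mem _ hx))
  | zero => simp
  | add x y _ _ hx hy => rw [map_add]; exact Submodule.add_mem _ hx hy
  | smul a x _ hx =>
    have := Submodule.smul_mem _ ((K2.toK k).symm a) hx
    simpa [M2.smul_def] using this

/-- The transport of functionals along an additive equivalence. -/
noncomputable def PhiMap (f : Module.Dual k M) : Module.Dual k N where
  toFun n := K2.toK k (dualComp (R := RR k) (M := M2 h) (lam1 k) (f ∘ₗ (M2.toM h).toLinearMap) ((M2.equiv h).symm n))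
  map_add' a b := by simp
  map_smul' c a := by
    have : (M2.equiv h).symm (c • a) = (K2.toK k).symm c • (M2.equiv h).symm a := by
      simp [M2.smul_def]
    rw [this, map_smul]
    simp

lemma PhiMap_apply (f : Module.Dual k M) (n : N) :
    PhiMap h f n = K2.toK k (dualComp (R := RR k) (M := M2 h) (lam1 k) (f ∘ₗ (M2.toM h).toLinearMap) ((M2.equiv h).symm n)) := rfl

lemma PhiMap_bijective [Module.Finite k M] [Module.Finite k N] : Function.Bijective (PhiMap h) := by
  obtain ⟨l2, hl2⟩ := exists_lam2 (k := k)
  have hb := dualComp_bijective (R := RR k) (M := M2 h) (lam1 k) exists_lam1.choose_spec.1 l2 hl2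
  constructor
  · intro f f' hff
    have hc : f ∘ₗ (M2.toM h).toLinearMap = f' ∘ₗ (M2.toM h).toLinearMap := by
     apply hb.1
     ext m
     have := congrArg (fun t => t (M2.equiv h m)) hff
     simp only [PhiMap_apply, AddEquiv.symm_apply_apply] at this
     exact (K2.toK k).injective this
    ext m
    exact congrArg (fun t => t ((M2.toM h).symm m)) hc
  · intro g
    let g' : M2 h →ₗ[K2 k] K2 k :=
      { toFun := fun m => (K2.toK k).symm (g (M2.equiv h m))
        map_add' := fun a b => by simp
        map_smul' := fun c a => by simp [M2.smul_def] }
    obtain ⟨f, hf⟩ := hb.2 g'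
    refine ⟨f ∘ₗ (M2.toM h).symm.toLinearMap, ?_⟩
    ext n
    have : (f ∘ₗ (M2.toM h).symm.toLinearMap) ∘ₗ (M2.toM h).toLinearMap = f := by ext; simp
    rw [PhiMap_apply, this, hf]
    simp [g']

lemma PhiMap_naturality {e' : M' ≃+ N'} (h' : CommActs k e') (g : M →ₗ[k] M') (g' : N →ₗ[k] N')
    (hg : ∀ m, e' (g m) = g' (e m)) (f : Module.Dual k M') (f' : Module.Dual k M) (hf : ∀ m, f' m = f (g m))
    (n : N) :
    PhiMap h f' n = PhiMap h' f (g' n) := by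
  have hgs : ∀ n, g (e.symm n) = e'.symm (g' n) := fun n => by
    rw [AddEquiv.eq_symm_apply, hg]; simp
  have hk : ∀ (y : K2 k) m, (M2.toM h').symm (g (M2.toM h (y • m))) = y • (M2.toM h').symm (g (M2.toM h m)) := by
    intro y m
    apply (M2.toM h').injective
    rw [M2.smul_def, M2.smul_def, M2.equiv_symm_eq, M2.equiv_symm_eq, LinearEquiv.apply_symm_apply,
      hgs, M2.equiv_eq, M2.equiv_eq, LinearEquiv.apply_symm_apply, map_smul, hg]
  let gR : M2 h →ₗ[RR k] M2 h' :=
    { toFun := fun m => (M2.toM h').symm (g (M2.toM h m))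
      map_add' := fun a b => by simp
      map_smul' := fun r m => by
        induction r using RR.ind with
        | h0 => simp
        | h2 x y hx hy =>
          simp only [RingHom.id_apply] at *
          rw [add_smul, add_smul, ← hx, ← hy]; simp
        | h1 x y =>
          rw [RingHom.id_apply, M2.tmul_smul, M2.tmul_smul, map_smul, map_smul, map_smul, hk] }
  rw [PhiMap_apply, PhiMap_apply, dualComp_naturality (R := RR k) (lam1 k) gR (f ∘ₗ (M2.toM h').toLinearMap)]
  · congr 2
    apply (M2.toM h').injective
    simp only [gR, LinearMap.coe_mk, AddHom.coe_mk, LinearEquiv.apply_symm_apply]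
    rw [M2.equiv_symm_eq, M2.equiv_symm_eq, hgs]
  · intro m
    simp [gR, hf]

lemma PhiMap_norm (f : Module.Dual k M) (m : M) (hm : ∀ d : k, f (e.symm (d • e m)) = d * f m) :
    PhiMap h f (e m) = f m := by
  rw [PhiMap_apply, dualComp_apply]
  have hh : (M2.equiv h).symm (e m) = (M2.toM h).symm m := e.symm_apply_apply m
  rw [hh]
  have : CoindE.sharp (R := RR k) (f ∘ₗ (M2.toM h).toLinearMap) ((M2.toM h).symm m) = (K2.toK k).symm (f m) • eps1 k := by
    ext r
    induction r using RR.ind with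
    | h0 => simp
    | h2 x y hx hy => rw [map_add, map_add, hx, hy]
    | h1 x y =>
      rw [CoindE.sharp_ev, M2.tmul_smul]
      have h1 : ((K2.toK k).symm (f m) • eps1 k).ev (RR.tm x y) =
        epsRing k (RR.tm 1 ((K2.toK k).symm (f m)) * RR.tm x y) := rfl
      rw [h1, map_mul, epsRing_tmul, epsRing_tmul, map_smul]
      have h2 : (f ∘ₗ (M2.toM h).toLinearMap) (y • ((M2.toM h).symm m)) = K2.toK k y * f m := hm (K2.toK k y)
      rw [h2]
      simp
      ring
  rw [this, map_smul, lam1, exists_lam1.choose_spec.2]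
  simp

end Phi

section SerreBasics

namespace RightSerreData

variable {k : Type*} [Field k] {E : Type*} [Category E] [Preadditive E] [CategoryTheory.Linear k E]
  {S : E ⥤ E} (D : RightSerreData k E S)

/-- the trace functional -/
noncomputable def tr (X : E) : Module.Dual k (X ⟶ S.obj X) := D.e X X (𝟙 X)

lemma e_eq {X Y : E} (h : X ⟶ Y) (u : Y ⟶ S.obj X) : D.e X Y h u = D.tr X (h ≫ u) := by
  rw [tr, ← D.nat_right, Category.id_comp]

lemma tr_comm {X X' : E} (f : X ⟶ X') (m : X' ⟶ S.obj X) :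
    D.tr X' (m ≫ S.map f) = D.tr X (f ≫ m) := by
  rw [tr, ← D.nat_left, Category.comp_id, e_eq]

lemma ext_right {X Y : E} {u u' : Y ⟶ S.obj X}
    (h : ∀ f : X ⟶ Y, D.tr X (f ≫ u) = D.tr X (f ≫ u')) : u = u' := by
  rw [← sub_eq_zero, ← Module.forall_dual_apply_eq_zero_iff k]
  intro φ
  obtain ⟨f, rfl⟩ := (D.e X Y).surjective φ
  rw [e_eq, Preadditive.comp_sub, map_sub, h, sub_self]

lemma ext_left {X Y : E} {f f' : X ⟶ Y}
    (h : ∀ u : Y ⟶ S.obj X, D.tr X (f ≫ u) = D.tr X (f' ≫ u)) : f = f' := by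
  apply (D.e X Y).injective
  ext u
  rw [e_eq, e_eq, h]

lemma exists_right [∀ X Y : E, FiniteDimensional k (X ⟶ Y)] {X Y : E} (φ : Module.Dual k (X ⟶ Y)) :
    ∃ u : Y ⟶ S.obj X, ∀ f, D.tr X (f ≫ u) = φ f := by
  obtain ⟨u, hu⟩ := (Module.evalEquiv k (Y ⟶ S.obj X)).surjective (φ ∘ₗ (D.e X Y).symm.toLinearMap)
  refine ⟨u, fun f => ?_⟩
  have := congrArg (fun t => t (D.e X Y f)) hu
  simpa [e_eq] using this

lemma additive (D : RightSerreData k E S) : S.Additive where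
  map_add {X Y f g} := by
    apply D.ext_right
    intro h
    rw [Preadditive.comp_add, map_add, tr_comm, tr_comm, tr_comm, Preadditive.add_comp, map_add]

end RightSerreData

end SerreBasics

section SerreAdjoint

variable {k : Type*} [Field k] {C : Type*} [Category C] [Preadditive C] [CategoryTheory.Linear k C]
  {D : Type*} [Category D] [Preadditive D] [CategoryTheory.Linear k D]

lemma commActs_adj {F : C ⥤ D} {G : D ⥤ C} (adj : F ⊣ G) [F.Additive] (X : C) (Y : D) :
    CommActs k (adj.homAddEquiv X Y).symm := by
  intro c d m
  change adj.homEquiv _ _ (d • (adj.homEquiv _ _).symm (c • m)) = c • adj.homEquiv _ _ (d • (adj.homEquiv _ _).symm m)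
  have h1 : ∀ m : X ⟶ G.obj Y, c • m = (c • 𝟙 X) ≫ m := fun m => by simp
  rw [h1, h1, Adjunction.homEquiv_naturality_left_symm, ← Linear.comp_smul, Adjunction.homEquiv_naturality_left]

/-- the functional attached to a morphism -/
noncomputable def serreAlpha {SC : C ⥤ C} (sC : RightSerreData k C SC) {Z X W : C} (i : W ⟶ SC.obj Z) (a : Z ⟶ X) :
    Module.Dual k (X ⟶ W) :=
  (sC.e Z X a) ∘ₗ Linear.rightComp k X i

lemma serreAlpha_apply {SC : C ⥤ C} (sC : RightSerreData k C SC) {Z X W : C} (i : W ⟶ SC.obj Z) (a : Z ⟶ X)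
    (m : X ⟶ W) : serreAlpha sC i a m = sC.tr Z (a ≫ m ≫ i) := by
  simp [serreAlpha, RightSerreData.e_eq]

lemma serreAlpha_bijective {SC : C ⥤ C} (sC : RightSerreData k C SC) {Z X W : C} (i : W ⟶ SC.obj Z) [IsIso i] :
    Function.Bijective (serreAlpha sC i : (Z ⟶ X) → _) := by
  constructor
  · intro a b h
    apply sC.ext_left
    intro u
    have := congrArg (fun t => t (u ≫ inv i)) h
    simpa [serreAlpha_apply] using this
  · intro f
    refine ⟨(sC.e Z X).symm (f ∘ₗ Linear.rightComp k X (inv i)), ?_⟩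
    ext m
    simp [serreAlpha]

variable [∀ X Y : C, FiniteDimensional k (X ⟶ Y)] [∀ X Y : D, FiniteDimensional k (X ⟶ Y)]

/-- The left adjoint obtained from Serre functors. -/
noncomputable def serreLeftAdj {F : C ⥤ D} {G : D ⥤ C} (adj : F ⊣ G) [F.Additive]
    {SC : C ⥤ C} {SD : D ⥤ D} (sC : RightSerreData k C SC) (sD : RightSerreData k D SD)
    (L : D ⥤ C) (θ : L ⋙ SC ≅ SD ⋙ G) : L ⊣ F := by
  let B : ∀ (Y : D) (X : C), (L.obj Y ⟶ X) → (Y ⟶ F.obj X) := fun Y X a =>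
    (sD.e Y (F.obj X)).symm (PhiMap (commActs_adj adj X (SD.obj Y)) (serreAlpha sC (θ.inv.app Y) a))
  have hB : ∀ Y X a n, sD.tr Y (B Y X a ≫ n) = PhiMap (commActs_adj adj X (SD.obj Y)) (serreAlpha sC (θ.inv.app Y) a) n := by
    intro Y X a n
    rw [← RightSerreData.e_eq]
    simp only [B, LinearEquiv.apply_symm_apply]
  have hbij : ∀ Y X, Function.Bijective (B Y X) := fun Y X =>
    (sD.e Y (F.obj X)).symm.bijective.comp ((PhiMap_bijective _).comp (serreAlpha_bijective sC _))
  have hnatR : ∀ Y X X' a (g : X ⟶ X'), B Y X' (a ≫ g) = B Y X a ≫ F.map g := by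
    intro Y X X' a g
    apply sD.ext_left
    intro n
    rw [hB, Category.assoc, hB]
    refine PhiMap_naturality _ _ (Linear.leftComp k _ g) (Linear.leftComp k _ (F.map g)) ?_ _ _ ?_ n
    · intro m
      exact adj.homEquiv_naturality_left_symm g m
    · intro m
      simp [serreAlpha_apply]
  have hnatL : ∀ Y Y' X (f : Y' ⟶ Y) a, B Y' X (L.map f ≫ a) = f ≫ B Y X a := by
    intro Y Y' X f a
    apply sD.ext_left
    intro n
    rw [hB, Category.assoc, ← sD.tr_comm, Category.assoc, hB]
    refine PhiMap_naturality _ _ (Linear.rightComp k _ (G.map (SD.map f))) (Linear.rightComp k _ (SD.map f)) ?_ _ _ ?_ n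
    · intro m
      exact adj.homEquiv_naturality_right_symm m (SD.map f)
    · intro m
      have := θ.inv.naturality f
      simp only [Functor.comp_map] at this
      simp only [serreAlpha_apply, Linear.rightComp_apply, Category.assoc, this]
      rw [← sC.tr_comm]
      simp
  exact Adjunction.mkOfHomEquiv
    { homEquiv := fun Y X => Equiv.ofBijective (B Y X) (hbij Y X)
      homEquiv_naturality_left_symm := fun {Y' Y X} f g => by
        apply (Equiv.ofBijective (B Y' X) (hbij Y' X)).injective
        rw [Equiv.apply_symm_apply]
        change _ = B Y' X _
        rw [hnatL]
        congr 1
        exact ((Equiv.ofBijective (B Y X) (hbij Y X)).apply_symm_apply g).symm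
      homEquiv_naturality_right := fun {Y X X'} f g => hnatR Y X X' f g }

/-- the right adjoint obtained from Serre functors -/
noncomputable def serreRightAdj {F : C ⥤ D} {G : D ⥤ C} (adj : F ⊣ G) [F.Additive]
    {SC : C ≌ C} {SD : D ≌ D} (sC : RightSerreData k C SC.functor) (sD : RightSerreData k D SD.functor) :
    G ⊣ SC.inverse ⋙ F ⋙ SD.functor := by
  have : SD.functor.Additive := sD.additive
  have : SC.functor.Additive := sC.additive
  have : SC.inverse.Additive := inferInstance
  have : SC.symm.functor.Additive := this
  exact serreLeftAdj (SC.symm.toAdjunction.comp (adj.comp SD.toAdjunction)) sC sD G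
    ((Functor.leftUnitor _).symm ≪≫ Functor.isoWhiskerRight SD.unitIso (G ⋙ SC.functor))

end SerreAdjoint

section CommShiftGen
variable {C : Type*} {D : Type*} [Category C] [Category D] [HasShift C ℤ] [HasShift D ℤ]

/-- commutation isomorphisms of a functor with one of the shifts -/
structure ShiftComm (F : C ⥤ D) where
  deg : ℤ
  iso : shiftFunctor C deg ⋙ F ≅ F ⋙ shiftFunctor D deg

namespace ShiftComm
variable {F : C ⥤ D}

noncomputable instance : Mul (ShiftComm F) := ⟨fun x y => ⟨x.deg + y.deg, Functor.CommShift.isoAdd x.iso y.iso⟩⟩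
noncomputable instance : One (ShiftComm F) := ⟨⟨0, Functor.CommShift.isoZero F ℤ⟩⟩

lemma mk_mul {a b c : ℤ} (h : a + b = c) (ea : shiftFunctor C a ⋙ F ≅ F ⋙ shiftFunctor D a)
    (eb : shiftFunctor C b ⋙ F ≅ F ⋙ shiftFunctor D b) :
    (⟨a, ea⟩ * ⟨b, eb⟩ : ShiftComm F) = ⟨c, Functor.CommShift.isoAdd' h ea eb⟩ := by
  subst h; rfl

/-- the inverse commutation isomorphism -/
noncomputable def invIso {a : ℤ} (ea : shiftFunctor C a ⋙ F ≅ F ⋙ shiftFunctor D a) :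
    shiftFunctor C (-a) ⋙ F ≅ F ⋙ shiftFunctor D (-a) :=
  (Functor.FullyFaithful.whiskeringRight (Functor.FullyFaithful.ofFullyFaithful (shiftFunctor D a)) C).preimageIso
    ((Functor.associator _ _ _) ≪≫ (Functor.isoWhiskerLeft _ ea.symm) ≪≫ (Functor.associator _ _ _).symm ≪≫
      Functor.isoWhiskerRight (shiftFunctorCompIsoId C (-a) a (by simp)) F ≪≫ F.leftUnitor ≪≫ F.rightUnitor.symm ≪≫
      Functor.isoWhiskerLeft F (shiftFunctorCompIsoId D (-a) a (by simp)).symm ≪≫ (Functor.associator _ _ _).symm)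

lemma isoAdd'_invIso {a : ℤ} (ea : shiftFunctor C a ⋙ F ≅ F ⋙ shiftFunctor D a) :
    Functor.CommShift.isoAdd' (show -a + a = 0 by simp) (invIso ea) ea =
      Functor.CommShift.isoZero F ℤ := by
  ext X
  simp [invIso, shiftFunctorCompIsoId]

noncomputable instance : Group (ShiftComm F) :=
  letI : Inv (ShiftComm F) := ⟨fun x => ⟨-x.deg, invIso x.iso⟩⟩
  Group.ofLeftAxioms
    (by
      rintro ⟨a, ea⟩ ⟨b, eb⟩ ⟨c, ec⟩
      rw [mk_mul (rfl : a + b = a + b), mk_mul (rfl : b + c = b + c), mk_mul (rfl : a + b + c = a + b + c),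
        mk_mul (show a + (b + c) = a + b + c by ring)]
      congr 1
      exact Functor.CommShift.isoAdd'_assoc ea eb ec rfl rfl rfl)
    (by
      rintro ⟨a, ea⟩
      change (⟨0, Functor.CommShift.isoZero F ℤ⟩ * ⟨a, ea⟩ : ShiftComm F) = _
      rw [mk_mul (zero_add a), Functor.CommShift.isoZero_isoAdd'_])
    (by
      rintro ⟨a, ea⟩
      change (⟨-a, invIso ea⟩ * ⟨a, ea⟩ : ShiftComm F) = ⟨0, Functor.CommShift.isoZero F ℤ⟩
      rw [mk_mul (show -a + a = 0 by simp), isoAdd'_invIso])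

/-- the degree as a homomorphism -/
noncomputable def degHom : ShiftComm F →* Multiplicative ℤ where
  toFun x := Multiplicative.ofAdd x.deg
  map_one' := rfl
  map_mul' _ _ := rfl

lemma deg_zpow (x : ShiftComm F) (n : ℤ) : (x ^ n).deg = n * x.deg := by
  have := map_zpow (degHom (F := F)) x n
  have h2 := congrArg Multiplicative.toAdd this
  simpa [degHom] using h2

lemma exists_iso_of_deg (x : ShiftComm F) {n : ℤ} (h : x.deg = n) :
    ∃ e : shiftFunctor C n ⋙ F ≅ F ⋙ shiftFunctor D n, x = ⟨n, e⟩ := by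
  subst h; exact ⟨x.iso, rfl⟩

lemma exists_commShift (e : shiftFunctor C (1 : ℤ) ⋙ F ≅ F ⋙ shiftFunctor D (1 : ℤ)) :
    ∃ c : F.CommShift ℤ, c.commShiftIso 1 = e := by
  have H : ∀ n : ℤ, ∃ e' : shiftFunctor C n ⋙ F ≅ F ⋙ shiftFunctor D n,
      (⟨1, e⟩ : ShiftComm F) ^ n = ⟨n, e'⟩ := fun n =>
    exists_iso_of_deg _ (by rw [deg_zpow]; simp)
  choose f hf using H
  refine ⟨{ commShiftIso := f, commShiftIso_zero := ?_, commShiftIso_add := ?_ }, ?_⟩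
  · have := hf 0
    rw [zpow_zero] at this
    injection this with _ h
    exact h.symm
  · intro a b
    have := hf (a + b)
    rw [zpow_add, hf a, hf b, mk_mul rfl] at this
    injection this with _ h
    exact h.symm
  · have := hf 1
    rw [zpow_one] at this
    injection this with _ h
    exact h.symm

end ShiftComm
end CommShiftGen

section TriWrap

variable {C : Type*} [Category C] [Preadditive C] [HasShift C ℤ] [∀ n : ℤ, (shiftFunctor C n).Additive]
  [HasZeroObject C] [Pretriangulated C]
  {X Y Z : C} {u : X ⟶ Y} {v : Y ⟶ Z} {w : Z ⟶ X⟦(1 : ℤ)⟧}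

lemma tk_yon2 (hT : Triangle.mk u v w ∈ distTriang C) {V : C} (f : Y ⟶ V) (hf : u ≫ f = 0) :
    ∃ g : Z ⟶ V, f = v ≫ g := Triangle.yoneda_exact₂ _ hT f hf

lemma tk_yon3 (hT : Triangle.mk u v w ∈ distTriang C) {V : C} (f : Z ⟶ V) (hf : v ≫ f = 0) :
    ∃ g : X⟦(1 : ℤ)⟧ ⟶ V, f = w ≫ g := Triangle.yoneda_exact₃ _ hT f hf

lemma tk_coyon1 (hT : Triangle.mk u v w ∈ distTriang C) {V : C} (f : V ⟶ X⟦(1 : ℤ)⟧) (hf : f ≫ u⟦(1 : ℤ)⟧' = 0) :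
    ∃ g : V ⟶ Z, f = g ≫ w := Triangle.coyoneda_exact₁ _ hT f hf

lemma tk_coyon2 (hT : Triangle.mk u v w ∈ distTriang C) {V : C} (f : V ⟶ Y) (hf : f ≫ v = 0) :
    ∃ g : V ⟶ X, f = g ≫ u := Triangle.coyoneda_exact₂ _ hT f hf

lemma tk_coyon3 (hT : Triangle.mk u v w ∈ distTriang C) {V : C} (f : V ⟶ Z) (hf : f ≫ w = 0) :
    ∃ g : V ⟶ Y, f = g ≫ v := Triangle.coyoneda_exact₃ _ hT f hf

lemma tk_compl {X' Y' Z' : C} {u' : X' ⟶ Y'} {v' : Y' ⟶ Z'} {w' : Z' ⟶ X'⟦(1 : ℤ)⟧}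
    (hT : Triangle.mk u v w ∈ distTriang C) (hT' : Triangle.mk u' v' w' ∈ distTriang C)
    (a : X ⟶ X') (b : Y ⟶ Y') (h : u ≫ b = a ≫ u') :
    ∃ c : Z ⟶ Z', v ≫ c = b ≫ v' ∧ w ≫ a⟦(1 : ℤ)⟧' = c ≫ w' :=
  complete_distinguished_triangle_morphism _ _ hT hT' a b h

lemma tk_compl1 {X' Y' Z' : C} {u' : X' ⟶ Y'} {v' : Y' ⟶ Z'} {w' : Z' ⟶ X'⟦(1 : ℤ)⟧}
    (hT : Triangle.mk u v w ∈ distTriang C) (hT' : Triangle.mk u' v' w' ∈ distTriang C)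
    (b : Y ⟶ Y') (c : Z ⟶ Z') (h : v ≫ c = b ≫ v') :
    ∃ a : X ⟶ X', u ≫ b = a ≫ u' ∧ w ≫ a⟦(1 : ℤ)⟧' = c ≫ w' :=
  complete_distinguished_triangle_morphism₁ _ _ hT hT' b c h

lemma tk_rot (hT : Triangle.mk u v w ∈ distTriang C) :
    Triangle.mk v w (-u⟦(1 : ℤ)⟧') ∈ distTriang C := rot_of_distTriang _ hT

end TriWrap

section SerreTriangulated

lemma exists_functional {k V W : Type*} [Field k] [AddCommGroup V] [Module k V] [AddCommGroup W] [Module k W]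
    (A : V →ₗ[k] W) (a : V →ₗ[k] k) (h : ∀ v, A v = 0 → a v = 0) : ∃ φ : Module.Dual k W, ∀ v, φ (A v) = a v := by
  have : a ∈ LinearMap.range A.dualMap := by
    rw [LinearMap.range_dualMap_eq_dualAnnihilator_ker, Submodule.mem_dualAnnihilator]
    intro v hv
    exact h v hv
  obtain ⟨φ, rfl⟩ := this
  exact ⟨φ, fun v => rfl⟩

variable {k : Type*} [Field k] {C : Type*} [Category C] [Preadditive C] [CategoryTheory.Linear k C]
  [HasShift C ℤ] [∀ n : ℤ, (shiftFunctor C n).Additive]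

/-- the additive equivalence given by the shift -/
noncomputable def shAdd (X Y : C) : (X ⟶ Y) ≃+ (X⟦(1 : ℤ)⟧ ⟶ Y⟦(1 : ℤ)⟧) :=
  { (Functor.FullyFaithful.ofFullyFaithful (shiftFunctor C (1 : ℤ))).homEquiv (X := X) (Y := Y) with
    map_add' := fun _ _ => (shiftFunctor C (1 : ℤ)).map_add }

lemma shAdd_apply {X Y : C} (f : X ⟶ Y) : shAdd X Y f = f⟦(1 : ℤ)⟧' := rfl

lemma map_shAdd_symm {X Y : C} (f : X⟦(1 : ℤ)⟧ ⟶ Y⟦(1 : ℤ)⟧) : ((shAdd X Y).symm f)⟦(1 : ℤ)⟧' = f :=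
  (shAdd X Y).apply_symm_apply f

lemma commActs_sh (X Y : C) : CommActs k (shAdd X Y) := by
  intro c d m
  apply (shAdd X Y).injective
  have h1 : ∀ m : X ⟶ Y, c • m = (c • 𝟙 X) ≫ m := fun m => by simp
  rw [h1, h1]
  simp only [shAdd_apply, Functor.map_comp, map_shAdd_symm, Linear.comp_smul]

variable [∀ X Y : C, FiniteDimensional k (X ⟶ Y)]
variable {S : C ⥤ C} (D : RightSerreData k C S)

namespace RightSerreData

/-- comparison of the Serre functor and the shift -/
noncomputable def psi (X : C) : (S.obj X)⟦(1 : ℤ)⟧ ⟶ S.obj (X⟦(1 : ℤ)⟧) :=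
  (D.exists_right (PhiMap (commActs_sh X (S.obj X)) (D.tr X))).choose

lemma tr_psi {X : C} (m : X⟦(1 : ℤ)⟧ ⟶ (S.obj X)⟦(1 : ℤ)⟧) :
    D.tr _ (m ≫ D.psi X) = PhiMap (commActs_sh X (S.obj X)) (D.tr X) m :=
  (D.exists_right (PhiMap (commActs_sh X (S.obj X)) (D.tr X))).choose_spec m

lemma tr_psi' {X Y : C} (h : X⟦(1 : ℤ)⟧ ⟶ Y⟦(1 : ℤ)⟧) (n : Y ⟶ S.obj X) :
    D.tr _ (h ≫ n⟦(1 : ℤ)⟧' ≫ D.psi X) =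
      PhiMap (commActs_sh X Y) (D.tr X ∘ₗ Linear.rightComp k X n) h := by
  rw [← Category.assoc, tr_psi]
  symm
  refine PhiMap_naturality _ _ (Linear.rightComp k X n) (Linear.rightComp k _ (n⟦(1 : ℤ)⟧')) ?_ _ _ ?_ h
  · intro m
    simp [shAdd_apply]
  · intro m
    simp

lemma psi_natural {X Y : C} (f : X ⟶ Y) :
    (S.map f)⟦(1 : ℤ)⟧' ≫ D.psi Y = D.psi X ≫ S.map (f⟦(1 : ℤ)⟧') := by
  apply D.ext_right
  intro m
  rw [tr_psi', ← Category.assoc m, tr_comm, ← Category.assoc, tr_psi]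
  refine PhiMap_naturality _ _ (Linear.leftComp k _ f) (Linear.leftComp k _ (f⟦(1 : ℤ)⟧')) ?_ _ _ ?_ m
  · intro m
    simp [shAdd_apply]
  · intro m
    simp [tr_comm]

lemma psi_inj {X Y : C} (n : Y ⟶ S.obj X) (hn : n⟦(1 : ℤ)⟧' ≫ D.psi X = 0) : n = 0 := by
  have h0 : (0 : Y ⟶ S.obj X)⟦(1 : ℤ)⟧' ≫ D.psi X = 0 := by simp
  have : (D.tr X ∘ₗ Linear.rightComp k X n) = (D.tr X ∘ₗ Linear.rightComp k X (0 : Y ⟶ S.obj X)) := by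
    apply (PhiMap_bijective (commActs_sh X Y)).1
    ext h
    rw [← tr_psi', ← tr_psi', hn, h0]
  apply D.ext_right
  intro f
  exact congrArg (fun t => t f) this

lemma psi_surj {X Y : C} (r : Y⟦(1 : ℤ)⟧ ⟶ S.obj (X⟦(1 : ℤ)⟧)) : ∃ n : Y ⟶ S.obj X, n⟦(1 : ℤ)⟧' ≫ D.psi X = r := by
  obtain ⟨g, hg⟩ := (PhiMap_bijective (commActs_sh (k := k) X Y)).2 (D.tr _ ∘ₗ Linear.rightComp k _ r)
  obtain ⟨n, hn⟩ := D.exists_right g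
  refine ⟨n, ?_⟩
  apply D.ext_right
  intro f
  have : D.tr X ∘ₗ Linear.rightComp k X n = g := by ext; simp [hn]
  rw [tr_psi', this, hg]
  simp

instance psi_isIso (X : C) : IsIso (D.psi X) := by
  have hm : Mono (D.psi X) := by
    refine Preadditive.mono_of_cancel_zero _ (fun {Z} n hn => ?_)
    let i := (shiftFunctor C (1 : ℤ)).objObjPreimageIso Z
    obtain ⟨n', hn'⟩ := (shiftFunctor C (1 : ℤ)).map_surjective (i.hom ≫ n)
    have : n' = 0 := D.psi_inj n' (by rw [hn', Category.assoc, hn, comp_zero])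
    rw [this, Functor.map_zero] at hn'
    rw [← cancel_epi i.hom, ← hn', comp_zero]
  have hs : IsSplitEpi (D.psi X) := by
    let i := (shiftFunctor C (1 : ℤ)).objObjPreimageIso (S.obj (X⟦(1 : ℤ)⟧))
    obtain ⟨n, hn⟩ := D.psi_surj i.hom
    exact ⟨⟨⟨i.inv ≫ n⟦(1 : ℤ)⟧', by rw [Category.assoc, hn, Iso.inv_hom_id]⟩⟩⟩
  exact isIso_of_mono_of_isSplitEpi _

lemma exact_lemma (D : RightSerreData k C S) {A B B' V : C} (α : A ⟶ B) (β : B ⟶ B')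
    (H : ∀ h : B ⟶ V, α ≫ h = 0 → ∃ h', h = β ≫ h') (s : V ⟶ S.obj B) (hs : s ≫ S.map β = 0) :
    ∃ s' : V ⟶ S.obj A, s = s' ≫ S.map α := by
  obtain ⟨σ, hσ⟩ := exists_functional (Linear.leftComp k V α) (D.tr B ∘ₗ Linear.rightComp k B s : (B ⟶ V) →ₗ[k] k) (by
    intro h hh
    obtain ⟨h', rfl⟩ := H h hh
    have : D.tr B (β ≫ (h' ≫ s)) = 0 := by
      rw [← tr_comm, Category.assoc, hs, comp_zero, map_zero]
    simpa using this)
  obtain ⟨s', hs'⟩ := D.exists_right σ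
  refine ⟨s', D.ext_right fun f => ?_⟩
  rw [← Category.assoc, tr_comm, ← Category.assoc, hs']
  exact (hσ f).symm

end RightSerreData

variable [HasZeroObject C] [Pretriangulated C]

namespace RightSerreData

lemma norm_lemma {X Y Z : C} {u : X ⟶ Y} {v : Y ⟶ Z} {w : Z ⟶ X⟦(1 : ℤ)⟧}
    (hT : Triangle.mk u v w ∈ distTriang C) (f : Y ⟶ S.obj X) (h : Z ⟶ S.obj Y) (hf : v ≫ h = f ≫ S.map u) (d : k) :
    D.tr X ((shAdd X (S.obj X)).symm (d • shAdd _ _ (u ≫ f))) = d * D.tr X (u ≫ f) := by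
  let ζ : ∀ A : C, A ⟶ A := fun A => (shAdd A A).symm (d • 𝟙 _)
  have hζT : ∀ A, (ζ A)⟦(1 : ℤ)⟧' = d • 𝟙 _ := fun A => map_shAdd_symm _
  have hζ : ∀ {A B : C} (x : A ⟶ B), ζ A ≫ x = x ≫ ζ B := by
    intro A B x
    apply (shiftFunctor C (1 : ℤ)).map_injective
    simp [hζT]
  have h1 : (shAdd X (S.obj X)).symm (d • shAdd _ _ (u ≫ f)) = ζ X ≫ u ≫ f := by
    apply (shAdd X (S.obj X)).injective
    rw [AddEquiv.apply_symm_apply]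
    simp [hζT, shAdd_apply]
  rw [h1, ← smul_eq_mul, ← map_smul, ← sub_eq_zero, ← map_sub]
  obtain ⟨γ, hγ1, hγ2⟩ := tk_compl hT hT (ζ X) (ζ Y) (hζ u).symm
  obtain ⟨β, hβ⟩ := tk_yon3 hT (γ - ζ Z) (by
    rw [Preadditive.comp_sub, hγ1, hζ, sub_self])
  obtain ⟨α, hα⟩ := tk_coyon3 hT (γ - d • 𝟙 Z) (by
    rw [Preadditive.sub_comp, ← hγ2, hζT]
    simp)
  have huv : u ≫ v = 0 := comp_distTriang_mor_zero₁₂ _ hT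
  have hvw : v ≫ w = 0 := comp_distTriang_mor_zero₂₃ _ hT
  have hd : ζ Z - d • 𝟙 Z = α ≫ v - w ≫ β := by rw [← hα, ← hβ]; abel
  have h2 : ζ X ≫ u ≫ f - d • (u ≫ f) = u ≫ (ζ Y - d • 𝟙 Y) ≫ f := by
    simp only [Preadditive.comp_sub, Preadditive.sub_comp, Linear.smul_comp, Category.id_comp, Linear.comp_smul]
    rw [← Category.assoc, hζ u, Category.assoc]
  have h3 : (ζ Y - d • 𝟙 Y) ≫ v = v ≫ (ζ Z - d • 𝟙 Z) := by
    simp [hζ v]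
  rw [h2, ← tr_comm, Category.assoc, ← hf, ← Category.assoc, h3, Category.assoc, ← tr_comm, hd]
  rw [Preadditive.sub_comp, Preadditive.sub_comp, map_sub]
  have h4 : D.tr Z (((α ≫ v) ≫ h) ≫ S.map v) = 0 := by
    rw [Category.assoc α, hf]
    simp only [Category.assoc, ← S.map_comp, huv]
    have := D.additive
    simp
  have h5 : D.tr Z (((w ≫ β) ≫ h) ≫ S.map v) = 0 := by
    rw [tr_comm]
    simp only [← Category.assoc, hvw]
    simp
  rw [h4, h5, sub_zero]

lemma tri_lemma {X Y Z W : C} {u : X ⟶ Y} {v : Y ⟶ Z} {w : Z ⟶ X⟦(1 : ℤ)⟧}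
    (hT : Triangle.mk u v w ∈ distTriang C) {g : S.obj Y ⟶ W} {g' : W ⟶ (S.obj X)⟦(1 : ℤ)⟧}
    (hT' : Triangle.mk (S.map u) g g' ∈ distTriang C) :
    ∃ φ : W ⟶ S.obj Z, IsIso φ ∧ g ≫ φ = S.map v ∧ φ ≫ S.map w = - (g' ≫ D.psi X) := by
  have hadd := D.additive
  have huv : u ≫ v = 0 := comp_distTriang_mor_zero₁₂ _ hT
  have hwu : w ≫ u⟦(1 : ℤ)⟧' = 0 := comp_distTriang_mor_zero₃₁ _ hT
  have hug : S.map u ≫ g = 0 := comp_distTriang_mor_zero₁₂ _ hT'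
  obtain ⟨φ0, hφ0⟩ := exists_functional
    ((Linear.rightComp k Z g) ∘ₗ LinearMap.fst k (Z ⟶ S.obj Y) (X⟦(1 : ℤ)⟧ ⟶ W) +
      (Linear.leftComp k W w) ∘ₗ LinearMap.snd k (Z ⟶ S.obj Y) (X⟦(1 : ℤ)⟧ ⟶ W))
    ((D.tr Y ∘ₗ Linear.leftComp k _ v) ∘ₗ LinearMap.fst k (Z ⟶ S.obj Y) (X⟦(1 : ℤ)⟧ ⟶ W) -
      (D.tr _ ∘ₗ Linear.rightComp k _ (g' ≫ D.psi X)) ∘ₗ LinearMap.snd k (Z ⟶ S.obj Y) (X⟦(1 : ℤ)⟧ ⟶ W)) (by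
    rintro ⟨h, h'⟩ hh
    simp only [LinearMap.add_apply, LinearMap.comp_apply, LinearMap.fst_apply, LinearMap.snd_apply,
      Linear.rightComp_apply, Linear.leftComp_apply, LinearMap.sub_apply] at hh ⊢
    obtain ⟨f, hf1, hf2⟩ := tk_compl1 (tk_rot hT) hT' h (-h') (by
      rw [Preadditive.comp_neg, neg_eq_of_add_eq_zero_left hh])
    have hg' : h' ≫ g' = (u ≫ f)⟦(1 : ℤ)⟧' := by
      rw [Functor.map_comp]
      simpa using hf2.symm
    rw [hf1, tr_comm, ← Category.assoc h', hg', tr_psi, ← shAdd_apply, PhiMap_norm, sub_self]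
    intro d
    exact D.norm_lemma hT f h hf1 d)
  obtain ⟨φ, hφ⟩ := D.exists_right φ0
  have e1 : g ≫ φ = S.map v := by
    apply D.ext_right
    intro h
    rw [tr_comm, ← Category.assoc, hφ]
    simpa using hφ0 (h, 0)
  have e2 : φ ≫ S.map w = - (g' ≫ D.psi X) := by
    apply D.ext_right
    intro h
    rw [← Category.assoc, tr_comm, ← Category.assoc, hφ, Preadditive.comp_neg]
    simpa using hφ0 (0, h)
  refine ⟨φ, ?_, e1, e2⟩
  have hm : Mono φ := by
    refine Preadditive.mono_of_cancel_zero _ (fun {V} n hn => ?_)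
    have h1 : n ≫ g' = 0 := by
      rw [← cancel_mono (D.psi X), zero_comp, Category.assoc, ← neg_eq_zero, ← Preadditive.comp_neg, ← e2,
        ← Category.assoc, hn, zero_comp]
    obtain ⟨n1, hn1⟩ := tk_coyon3 hT' n h1
    subst hn1
    obtain ⟨n2, rfl⟩ := D.exact_lemma u v (fun h hh => tk_yon2 hT h hh) n1 (by
      rw [← e1, ← Category.assoc, hn])
    rw [Category.assoc, hug, comp_zero]
  have hs : IsSplitEpi φ := by
    obtain ⟨n, hn⟩ := tk_coyon1 hT' (-(S.map w ≫ inv (D.psi X))) (by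
      have : inv (D.psi X) ≫ (S.map u)⟦(1 : ℤ)⟧' = S.map (u⟦(1 : ℤ)⟧') ≫ inv (D.psi Y) := by
        rw [IsIso.inv_comp_eq, ← Category.assoc, IsIso.eq_comp_inv, psi_natural]
      rw [Preadditive.neg_comp, Category.assoc, this, ← Category.assoc, ← S.map_comp, hwu]
      simp)
    obtain ⟨n1, hn1⟩ := D.exact_lemma v w (fun h hh => tk_yon3 hT h hh) (𝟙 _ - n ≫ φ) (by
      rw [Preadditive.sub_comp, Category.assoc, e2, Preadditive.comp_neg, ← Category.assoc, ← hn]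
      simp)
    refine ⟨⟨⟨n + n1 ≫ g, ?_⟩⟩⟩
    rw [Preadditive.add_comp, Category.assoc, e1, ← hn1]
    abel
  exact isIso_of_mono_of_isSplitEpi _

/-- the comparison up to sign -/
noncomputable def negPsi (X : C) : (S.obj X)⟦(1 : ℤ)⟧ ≅ S.obj (X⟦(1 : ℤ)⟧) where
  hom := -(D.psi X)
  inv := -(inv (D.psi X))

/-- the commutation isomorphism -/
noncomputable def commIso : shiftFunctor C (1 : ℤ) ⋙ S ≅ S ⋙ shiftFunctor C (1 : ℤ) :=
  (NatIso.ofComponents (fun X => D.negPsi X) (fun f => by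
    have := D.psi_natural f
    simp [negPsi, this]) : S ⋙ shiftFunctor C (1 : ℤ) ≅ shiftFunctor C (1 : ℤ) ⋙ S).symm

lemma isTriangleFunctor (D : RightSerreData k C S) : IsTriangleFunctor S := by
  have hadd := D.additive
  obtain ⟨c, hc⟩ := ShiftComm.exists_commShift D.commIso
  refine ⟨c, ⟨fun T hT => ?_⟩⟩
  obtain ⟨X, Y, Z, u, v, w⟩ := T
  obtain ⟨W, g, g', hT'⟩ := distinguished_cocone_triangle (S.map u)
  obtain ⟨φ, hφ, e1, e2⟩ := D.tri_lemma hT hT'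
  refine isomorphic_distinguished _ hT' _ (Iso.symm ?_)
  refine Triangle.isoMk _ _ (Iso.refl _) (Iso.refl _) (@asIso C _ _ _ φ hφ) ?_ ?_ ?_
  · change S.map u ≫ 𝟙 _ = 𝟙 _ ≫ S.map u
    simp
  · change g ≫ φ = 𝟙 _ ≫ S.map v
    simp [e1]
  · have h1 : (S.commShiftIso (1 : ℤ)).hom.app X = (D.commIso).hom.app X := by
      rw [← hc]
    have h2 : (-(D.psi X)) ≫ (D.commIso).hom.app X = 𝟙 _ := (D.commIso).inv_hom_id_app X
    rw [Preadditive.neg_comp] at h2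
    change g' ≫ (𝟙 _)⟦(1 : ℤ)⟧' = φ ≫ S.map w ≫ (S.commShiftIso (1 : ℤ)).hom.app X
    rw [h1, ← Category.assoc, e2, Preadditive.neg_comp, Category.assoc, ← Preadditive.comp_neg, h2]
    simp

end RightSerreData

end SerreTriangulated

section TriFun

variable {C D E : Type*} [Category C] [Category D] [Category E]
  [HasShift C ℤ] [HasShift D ℤ] [HasShift E ℤ]
  [Preadditive C] [Preadditive D] [Preadditive E]
  [HasZeroObject C] [HasZeroObject D] [HasZeroObject E]
  [∀ n : ℤ, (shiftFunctor C n).Additive] [∀ n : ℤ, (shiftFunctor D n).Additive]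
  [∀ n : ℤ, (shiftFunctor E n).Additive]
  [Pretriangulated C] [Pretriangulated D] [Pretriangulated E]

lemma IsTriangleFunctor.id : IsTriangleFunctor (𝟭 C) := ⟨inferInstance, inferInstance⟩

lemma IsTriangleFunctor.comp {F : C ⥤ D} {G : D ⥤ E} (hF : IsTriangleFunctor F)
    (hG : IsTriangleFunctor G) : IsTriangleFunctor (F ⋙ G) := by
  obtain ⟨c, h⟩ := hF
  obtain ⟨c', h'⟩ := hG
  exact ⟨inferInstance, inferInstance⟩

lemma IsTriangleFunctor.of_iso {F G : C ⥤ D} (hF : IsTriangleFunctor F) (e : F ≅ G) :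
    IsTriangleFunctor G := by
  obtain ⟨c, h⟩ := hF
  let := Functor.CommShift.ofIso e ℤ
  have := Functor.CommShift.ofIso_compatibility e ℤ
  exact ⟨inferInstance, Functor.isTriangulated_of_iso e⟩

lemma IsTriangleFunctor.additive {F : C ⥤ D} (hF : IsTriangleFunctor F) : F.Additive := by
  obtain ⟨c, h⟩ := hF
  infer_instance

lemma IsTriangleFunctor.rightAdjoint {F : C ⥤ D} {G : D ⥤ C} (hF : IsTriangleFunctor F) (adj : F ⊣ G) :
    IsTriangleFunctor G := by
  obtain ⟨c, h⟩ := hF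
  let := adj.rightAdjointCommShift ℤ
  have := adj.commShift_of_leftAdjoint ℤ
  exact ⟨inferInstance, adj.isTriangulated_rightAdjoint⟩

lemma IsTriangleFunctor.map_dist {F : C ⥤ D} (hF : IsTriangleFunctor F) {X Y Z : C} {u : X ⟶ Y}
    {v : Y ⟶ Z} {w : Z ⟶ X⟦(1 : ℤ)⟧} (hT : Triangle.mk u v w ∈ distTriang C) :
    ∃ w', Triangle.mk (F.map u) (F.map v) w' ∈ distTriang D := by
  obtain ⟨c, h⟩ := hF
  exact ⟨_, F.map_distinguished _ hT⟩

end TriFun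

section LeftRec

variable {C C' C'' : Type*} [Category C] [Category C'] [Category C'']
  [HasShift C ℤ] [HasShift C' ℤ] [HasShift C'' ℤ]
  [Preadditive C] [Preadditive C'] [Preadditive C'']
  [HasZeroObject C] [HasZeroObject C'] [HasZeroObject C'']
  [∀ n : ℤ, (shiftFunctor C n).Additive] [∀ n : ℤ, (shiftFunctor C' n).Additive]
  [∀ n : ℤ, (shiftFunctor C'' n).Additive]
  [Pretriangulated C] [Pretriangulated C'] [Pretriangulated C'']

/-- a version of left recollements without reference to units and counits -/
structure WeakLeftRec (p : C ⥤ C') (a : C' ⥤ C) (b : C'' ⥤ C) (q : C ⥤ C'') : Prop where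
  adjI : Nonempty (p ⊣ a)
  adjJ : Nonempty (b ⊣ q)
  full_a : a.Full
  faithful_a : a.Faithful
  full_b : b.Full
  faithful_b : b.Faithful
  zero : ∀ X, IsZero (q.obj (a.obj X))
  tri : ∀ X : C, ∃ (Y : C'') (Z : C') (X' : C) (A B : C) (u : A ⟶ X') (v : X' ⟶ B) (w : B ⟶ A⟦(1 : ℤ)⟧),
    Triangle.mk u v w ∈ distTriang C ∧ Nonempty (X' ≅ X) ∧ Nonempty (b.obj Y ≅ A) ∧ Nonempty (a.obj Z ≅ B)

lemma IsLeftRecollement.weak {p : C ⥤ C'} {a : C' ⥤ C} {b : C'' ⥤ C} {q : C ⥤ C''}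
    (h : IsLeftRecollement p a b q) : WeakLeftRec p a b q := by
  obtain ⟨adjI, adjJ, h1, h2, h3, h4, h5, h6⟩ := h
  refine ⟨⟨adjI⟩, ⟨adjJ⟩, h1, h2, h3, h4, h5, fun X => ?_⟩
  obtain ⟨w, hw⟩ := h6 X
  exact ⟨_, _, _, _, _, _, _, _, hw, ⟨Iso.refl _⟩, ⟨Iso.refl _⟩, ⟨Iso.refl _⟩⟩

lemma WeakLeftRec.isLeftRecollement {p : C ⥤ C'} {a : C' ⥤ C} {b : C'' ⥤ C} {q : C ⥤ C''}
    (h : WeakLeftRec p a b q) (hp : IsTriangleFunctor p) (hq : IsTriangleFunctor q) :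
    IsLeftRecollement p a b q := by
  obtain ⟨⟨adjI⟩, ⟨adjJ⟩, h1, h2, h3, h4, h5, h6⟩ := h
  refine ⟨adjI, adjJ, h1, h2, h3, h4, h5, fun X => ?_⟩
  have hzero : ∀ Y, IsZero (p.obj (b.obj Y)) := by
    intro Y
    rw [IsZero.iff_id_eq_zero]
    apply (adjI.homEquiv _ _).injective
    apply (adjJ.homEquiv _ _).injective
    exact (h5 _).eq_of_tgt _ _
  obtain ⟨Y, Z, X', A, B, u, v, w, hT, ⟨eX⟩, ⟨eA⟩, ⟨eB⟩⟩ := h6 X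
  obtain ⟨w1, hT1⟩ := hp.map_dist hT
  obtain ⟨w2, hT2⟩ := hq.map_dist hT
  have i1 : IsIso (p.map v) := (Triangle.isZero₁_iff_isIso₂ _ hT1).1 ((hzero Y).of_iso (p.mapIso eA.symm))
  have i2 : IsIso (q.map u) := (Triangle.isZero₃_iff_isIso₁ _ hT2).1 ((h5 Z).of_iso (q.mapIso eB.symm))
  let f : Y ⟶ q.obj X := adjJ.unit.app Y ≫ q.map (eA.hom ≫ u ≫ eX.hom)
  let g : p.obj X ⟶ Z := p.map (eX.inv ≫ v ≫ eB.inv) ≫ adjI.counit.app Z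
  have if' : IsIso f := by
    simp only [f, Functor.map_comp]
    infer_instance
  have ig : IsIso g := by
    simp only [g, Functor.map_comp]
    infer_instance
  have hf : b.map f ≫ adjJ.counit.app X = eA.hom ≫ u ≫ eX.hom := by
    simp [f]
  have hg : adjI.unit.app X ≫ a.map g = eX.inv ≫ v ≫ eB.inv := by
    simp [g]
  let α : A ≅ b.obj (q.obj X) := eA.symm ≪≫ b.mapIso (asIso f)
  let γ : B ≅ a.obj (p.obj X) := eB.symm ≪≫ (a.mapIso (asIso g)).symm
  refine ⟨γ.inv ≫ w ≫ α.hom⟦(1 : ℤ)⟧', isomorphic_distinguished _ hT _ (Iso.symm ?_)⟩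
  refine Triangle.isoMk _ _ α eX γ ?_ ?_ ?_
  · change u ≫ eX.hom = (eA.inv ≫ b.map f) ≫ adjJ.counit.app X
    rw [Category.assoc, hf, Iso.inv_hom_id_assoc]
  · have hγ : γ.hom = eB.inv ≫ inv (a.map g) := by simp [γ]
    change v ≫ γ.hom = eX.hom ≫ adjI.unit.app X
    rw [hγ]
    rw [← Category.assoc, IsIso.comp_inv_eq, Category.assoc, hg, Iso.hom_inv_id_assoc]
  · change w ≫ α.hom⟦(1 : ℤ)⟧' = γ.hom ≫ γ.inv ≫ w ≫ α.hom⟦(1 : ℤ)⟧'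
    rw [Iso.hom_inv_id_assoc]

lemma WeakLeftRec.of_iso {p p' : C ⥤ C'} {a a' : C' ⥤ C} {b b' : C'' ⥤ C} {q q' : C ⥤ C''}
    (h : WeakLeftRec p a b q) (ep : p ≅ p') (ea : a ≅ a') (eb : b ≅ b') (eq : q ≅ q') :
    WeakLeftRec p' a' b' q' := by
  obtain ⟨⟨adjI⟩, ⟨adjJ⟩, h1, h2, h3, h4, h5, h6⟩ := h
  refine ⟨⟨(adjI.ofNatIsoLeft ep).ofNatIsoRight ea⟩, ⟨(adjJ.ofNatIsoLeft eb).ofNatIsoRight eq⟩,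
    Functor.Full.of_iso ea, Functor.Faithful.of_iso ea, Functor.Full.of_iso eb,
    Functor.Faithful.of_iso eb, fun X => ?_, fun X => ?_⟩
  · exact (h5 X).of_iso (q'.mapIso (ea.symm.app X) ≪≫ eq.symm.app _)
  · obtain ⟨Y, Z, X', A, B, u, v, w, hT, ⟨eX⟩, ⟨eA⟩, ⟨eB⟩⟩ := h6 X
    exact ⟨Y, Z, X', A, B, u, v, w, hT, ⟨eX⟩, ⟨eb.symm.app _ ≪≫ eA⟩, ⟨ea.symm.app _ ≪≫ eB⟩⟩

/-- conjugation of a functor by equivalences -/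
def cj {A B : Type*} [Category A] [Category B] (E : A ≌ A) (E' : B ≌ B) (F : A ⥤ B) : A ⥤ B :=
  E.inverse ⋙ F ⋙ E'.functor

/-- conjugation is compatible with adjunctions -/
def cjAdj {A B : Type*} [Category A] [Category B] (E : A ≌ A) (E' : B ≌ B) {F : A ⥤ B} {G : B ⥤ A}
    (adj : F ⊣ G) : cj E E' F ⊣ cj E' E G :=
  (E.symm.toAdjunction.comp adj).comp E'.toAdjunction

lemma WeakLeftRec.conj {p : C ⥤ C'} {a : C' ⥤ C} {b : C'' ⥤ C} {q : C ⥤ C''}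
    (h : WeakLeftRec p a b q) (E : C ≌ C) (E' : C' ≌ C') (E'' : C'' ≌ C'')
    (hE : IsTriangleFunctor E.functor) :
    WeakLeftRec (cj E E' p) (cj E' E a) (cj E'' E b) (cj E E'' q) := by
  obtain ⟨⟨adjI⟩, ⟨adjJ⟩, h1, h2, h3, h4, h5, h6⟩ := h
  refine ⟨⟨cjAdj _ _ adjI⟩, ⟨cjAdj _ _ adjJ⟩, ?_, ?_, ?_, ?_, fun X => ?_, fun X => ?_⟩
  · unfold cj; infer_instance
  · unfold cj; infer_instance
  · unfold cj; infer_instance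
  · unfold cj; infer_instance
  · have hadd : E''.functor.PreservesZeroMorphisms := inferInstance
    exact (E''.functor.map_isZero (h5 (E'.inverse.obj X))).of_iso
      (E''.functor.mapIso (q.mapIso (E.unitIso.symm.app _)))
  · obtain ⟨Y, Z, X', A, B, u, v, w, hT, ⟨eX⟩, ⟨eA⟩, ⟨eB⟩⟩ := h6 (E.inverse.obj X)
    obtain ⟨w', hT'⟩ := hE.map_dist hT
    exact ⟨E''.functor.obj Y, E'.functor.obj Z, _, _, _, _, _, _, hT',
      ⟨E.functor.mapIso eX ≪≫ E.counitIso.app X⟩,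
      ⟨E.functor.mapIso (b.mapIso (E''.unitIso.symm.app Y) ≪≫ eA)⟩,
      ⟨E.functor.mapIso (a.mapIso (E'.unitIso.symm.app Z) ≪≫ eB)⟩⟩

lemma IsTriangleFunctor.conj {F : C ⥤ C'} (h : IsTriangleFunctor F) {E : C ≌ C} {E' : C' ≌ C'}
    (hE : IsTriangleFunctor E.inverse) (hE' : IsTriangleFunctor E'.functor) :
    IsTriangleFunctor (cj E E' F) := hE.comp (h.comp hE')

end LeftRec

section EqPow

/-- natural powers of an auto-equivalence -/
def eqNat {A : Type*} [Category A] (E : A ≌ A) : ℕ → (A ≌ A)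
  | 0 => CategoryTheory.Equivalence.refl
  | n + 1 => E.trans (eqNat E n)

/-- integral powers of an auto-equivalence -/
def eqPow {A : Type*} [Category A] (E : A ≌ A) : ℤ → (A ≌ A)
  | Int.ofNat n => eqNat E n
  | Int.negSucc n => eqNat E.symm (n + 1)

lemma eqPow_succ {A : Type*} [Category A] (E : A ≌ A) (n : ℤ) :
    Nonempty ((eqPow E (n + 1)).functor ≅ E.functor ⋙ (eqPow E n).functor) := by
  match n with
  | Int.ofNat n => exact ⟨Iso.refl _⟩
  | Int.negSucc 0 => exact ⟨E.unitIso⟩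
  | Int.negSucc (n + 1) =>
    exact ⟨(Functor.leftUnitor _).symm ≪≫ Functor.isoWhiskerRight E.unitIso (eqNat E.symm (n + 1)).functor⟩

lemma eqPow_succ_inv {A : Type*} [Category A] (E : A ≌ A) (n : ℤ) :
    Nonempty ((eqPow E (n + 1)).inverse ≅ (eqPow E n).inverse ⋙ E.inverse) := by
  obtain ⟨i⟩ := eqPow_succ E n
  exact ⟨Iso.isoInverseOfIsoFunctor (G := eqPow E (n + 1)) (G' := E.trans (eqPow E n)) i⟩

lemma cj_succ {A B : Type*} [Category A] [Category B] (E : A ≌ A) (E' : B ≌ B) (F G : A ⥤ B)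
    (e : G ≅ cj E E' F) (n : ℤ) :
    Nonempty (cj (eqPow E n) (eqPow E' n) G ≅ cj (eqPow E (n + 1)) (eqPow E' (n + 1)) F) := by
  obtain ⟨i⟩ := eqPow_succ E' n
  obtain ⟨j⟩ := eqPow_succ_inv E n
  refine ⟨Functor.isoWhiskerLeft (eqPow E n).inverse (Functor.isoWhiskerRight e (eqPow E' n).functor) ≪≫ ?_⟩
  exact Functor.isoWhiskerLeft ((eqPow E n).inverse ⋙ E.inverse ⋙ F) i.symm ≪≫
    Functor.isoWhiskerRight j.symm (F ⋙ (eqPow E' (n + 1)).functor)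

lemma cj_one_inv {A B : Type*} [Category A] [Category B] (E : A ≌ A) (E' : B ≌ B) (F G : A ⥤ B)
    (e : G ≅ cj E E' F) : Nonempty (G ⋙ E'.inverse ≅ E.inverse ⋙ F) :=
  ⟨Functor.isoWhiskerRight e E'.inverse ≪≫ Functor.isoWhiskerLeft (E.inverse ⋙ F) E'.unitIso.symm ≪≫
    Functor.rightUnitor _⟩

lemma eqPow_tri {C : Type*} [Category C] [HasShift C ℤ] [Preadditive C] [HasZeroObject C]
    [∀ n : ℤ, (shiftFunctor C n).Additive] [Pretriangulated C] (E : C ≌ C)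
    (hE : IsTriangleFunctor E.functor) (n : ℤ) :
    IsTriangleFunctor (eqPow E n).functor ∧ IsTriangleFunctor (eqPow E n).inverse := by
  have hE' : IsTriangleFunctor E.inverse := hE.rightAdjoint E.toAdjunction
  suffices IsTriangleFunctor (eqPow E n).functor from ⟨this, this.rightAdjoint (eqPow E n).toAdjunction⟩
  match n with
  | Int.ofNat n =>
    induction n with
    | zero => exact IsTriangleFunctor.id
    | succ n ih => exact hE.comp ih
  | Int.negSucc n =>
    induction n with
    | zero => exact hE'.comp IsTriangleFunctor.id
    | succ n ih => exact hE'.comp ih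

end EqPow

section Statement

universe w v v' v'' u u' u''

variable (k : Type w) [Field k]
variable {C : Type u} {C' : Type u'} {C'' : Type u''}
  [Category.{v} C] [Category.{v'} C'] [Category.{v''} C'']
  [HasShift C ℤ] [HasShift C' ℤ] [HasShift C'' ℤ]
  [Preadditive C] [Preadditive C'] [Preadditive C'']
  [HasZeroObject C] [HasZeroObject C'] [HasZeroObject C'']
  [∀ n : ℤ, (shiftFunctor C n).Additive] [∀ n : ℤ, (shiftFunctor C' n).Additive]
  [∀ n : ℤ, (shiftFunctor C'' n).Additive]
  [Pretriangulated C] [Pretriangulated C'] [Pretriangulated C'']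
  [CategoryTheory.Linear k C] [CategoryTheory.Linear k C'] [CategoryTheory.Linear k C'']
  [∀ X Y : C, FiniteDimensional k (X ⟶ Y)]
  [∀ X Y : C', FiniteDimensional k (X ⟶ Y)]
  [∀ X Y : C'', FiniteDimensional k (X ⟶ Y)]

/-- **Proposition 3.1 (1)(ii).** If `𝒞'`, `𝒞`, `𝒞''` are Hom-finite `k`-linear triangulated
categories with Serre functors, then any recollement `(𝒞', 𝒞, 𝒞'')` sits in an unbounded
ladder of period `1`. -/
theorem recollement_sits_in_ladder_of_period_one_of_hasSerreFunctor
    (hC' : HasSerreFunctor k C') (hC : HasSerreFunctor k C) (hC'' : HasSerreFunctor k C'')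
    (iStar : C ⥤ C') (iPush : C' ⥤ C) (iShriek : C ⥤ C')
    (jShriek : C'' ⥤ C) (jStar : C ⥤ C'') (jPush : C'' ⥤ C)
    (tiStar : IsTriangleFunctor iStar) (tiPush : IsTriangleFunctor iPush)
    (tiShriek : IsTriangleFunctor iShriek) (tjShriek : IsTriangleFunctor jShriek)
    (tjStar : IsTriangleFunctor jStar) (tjPush : IsTriangleFunctor jPush)
    (hrec : IsRecollement iStar iPush iShriek jShriek jStar jPush) :
    SitsInUnboundedLadderOfPeriod iStar iPush iShriek jShriek jStar jPush 1 := by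
  obtain ⟨S, ⟨s⟩, hS⟩ := hC
  obtain ⟨S', ⟨s'⟩, hS'⟩ := hC'
  obtain ⟨S'', ⟨s''⟩, hS''⟩ := hC''
  let E : C ≌ C := S.asEquivalence
  let E' : C' ≌ C' := S'.asEquivalence
  let E'' : C'' ≌ C'' := S''.asEquivalence
  have tE : IsTriangleFunctor E.functor := s.isTriangleFunctor
  have tE' : IsTriangleFunctor E'.functor := s'.isTriangleFunctor
  have tE'' : IsTriangleFunctor E''.functor := s''.isTriangleFunctor
  obtain ⟨adjI₁, adjI₂, adjJ₁, adjJ₂, h1, h2, h3, h4, h5, h6, h7, h8, h9⟩ := hrec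
  have hL : IsLeftRecollement iStar iPush jShriek jStar :=
    ⟨adjI₁, adjJ₁, h1, h2, h3, h4, h7, h8⟩
  have hz : ∀ Y, IsZero (iShriek.obj (jPush.obj Y)) := by
    intro Y
    have := tiShriek.additive
    rw [IsZero.iff_id_eq_zero]
    apply (adjI₂.homEquiv _ _).symm.injective
    apply (adjJ₂.homEquiv _ _).symm.injective
    exact (h7 _).eq_of_src _ _
  have hR : IsLeftRecollement jStar jPush iPush iShriek :=
    ⟨adjJ₂, adjI₂, h5, h6, h1, h2, hz, h9⟩
  have aStar := tiStar.additive
  have aShriek := tjShriek.additive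
  have e1 : iShriek ≅ cj E E' iStar :=
    adjI₂.rightAdjointUniq (serreRightAdj (SC := E) (SD := E') adjI₁ s s')
  have e2 : jPush ≅ cj E'' E jShriek :=
    adjJ₂.rightAdjointUniq (serreRightAdj (SC := E'') (SD := E) adjJ₁ s'' s)
  let a : ℤ → C' ⥤ C := fun n => cj (eqPow E' n) (eqPow E n) iPush
  let q : ℤ → C ⥤ C'' := fun n => cj (eqPow E n) (eqPow E'' n) jStar
  let p : ℤ → C ⥤ C' := fun n => if n = 1 then iShriek else cj (eqPow E n) (eqPow E' n) iStar
  let b : ℤ → C'' ⥤ C := fun n => if n = 1 then jPush else cj (eqPow E'' n) (eqPow E n) jShriek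
  have hp : ∀ n, Nonempty (cj (eqPow E n) (eqPow E' n) iStar ≅ p n) := by
    intro n
    by_cases hn : n = 1
    · subst hn
      exact ⟨e1.symm⟩
    · exact ⟨eqToIso (if_neg hn).symm⟩
  have hb : ∀ n, Nonempty (cj (eqPow E'' n) (eqPow E n) jShriek ≅ b n) := by
    intro n
    by_cases hn : n = 1
    · subst hn
      exact ⟨e2.symm⟩
    · exact ⟨eqToIso (if_neg hn).symm⟩
  have ta : ∀ n, IsTriangleFunctor (a n) := fun n =>
    tiPush.conj (eqPow_tri E' tE' n).2 (eqPow_tri E tE n).1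
  have tq : ∀ n, IsTriangleFunctor (q n) := fun n =>
    tjStar.conj (eqPow_tri E tE n).2 (eqPow_tri E'' tE'' n).1
  have tp : ∀ n, IsTriangleFunctor (p n) := fun n =>
    (tiStar.conj (eqPow_tri E tE n).2 (eqPow_tri E' tE' n).1).of_iso (hp n).some
  have tb : ∀ n, IsTriangleFunctor (b n) := fun n =>
    (tjShriek.conj (eqPow_tri E'' tE'' n).2 (eqPow_tri E tE n).1).of_iso (hb n).some
  refine ⟨a, b, p, q, ⟨ta, tb, tp, tq, fun n => ?_, fun n => ?_⟩, rfl, rfl, rfl, rfl, rfl, rfl,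
    one_pos, ?_, fun s hs hs' => by omega⟩
  · exact ((hL.weak.conj (eqPow E n) (eqPow E' n) (eqPow E'' n) (eqPow_tri E tE n).1).of_iso
      (hp n).some (Iso.refl _) (hb n).some (Iso.refl _)).isLeftRecollement (tp n) (tq n)
  · exact ((hR.weak.conj (eqPow E n) (eqPow E'' n) (eqPow E' n) (eqPow_tri E tE n).1).of_iso
      (Iso.refl _) ((cj_succ _ _ _ _ e2 n).some ≪≫ (hb (n + 1)).some) (Iso.refl _)
      ((cj_succ _ _ _ _ e1 n).some ≪≫ (hp (n + 1)).some)).isLeftRecollement (tq n) (tp (n + 1))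
  · refine ⟨E'.inverse, E.inverse, E''.inverse, inferInstance, inferInstance, inferInstance,
      tE'.rightAdjoint E'.toAdjunction, tE.rightAdjoint E.toAdjunction,
      tE''.rightAdjoint E''.toAdjunction, ?_, ?_, ?_, ?_⟩
    · exact cj_one_inv E E' iStar iShriek e1
    · exact cj_one_inv E' E iPush (a 1) (Iso.refl _)
    · exact cj_one_inv E'' E jShriek jPush e2
    · exact cj_one_inv E E'' jStar (q 1) (Iso.refl _)

end Statement
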